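/- Let d ≥ 3, n, m ≥ 1, N = (n+1)·C(m+d,d) − 1, and let s_1 be the largest multiple of (n+1) at most ⌊(n+1)·C(m+d,d)/(m+n+1)⌋ and s_2 the smallest multiple of (n+1) at least ⌈(n+1)·C(m+d,d)/(m+n+1)⌉. Then for any s ≤ s_1, the s-th higher secant variety σ_s(X^{(n,m)}_{(1,d)}) ⊂ P^N has dimension s(n+m+1) − 1, and for any s ≥ s_2 it has dimension N; in particular it has the expected dimension min{N, s(n+m+2) − 1} in both ranges. -/

import Mathlib

open MvPolynomial

noncomputable section

/-- The (radical, homogeneous for cones) vanishing ideal of a set `S` of vectors. -/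
def vIdeal (K : Type) [Field K] {ι : Type} (S : Set (ι → K)) : Ideal (MvPolynomial ι K) :=
  ⨅ x ∈ S, RingHom.ker (MvPolynomial.eval x)

/-- Krull dimension of the homogeneous coordinate ring of the (Zariski closure of the)
cone `S`; for a projective variety of dimension `D` this equals `D + 1`. -/
def coneKrullDim (K : Type) [Field K] {ι : Type} (S : Set (ι → K)) : WithBot ℕ∞ :=
  ringKrullDim (MvPolynomial ι K ⧸ vIdeal K S)

/-- The projective variety whose affine cone is the Zariski closure of `S` has
dimension `D` (dimension of a projective variety = Krull dimension of its homogeneous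
coordinate ring minus one). -/
def HasProjDim (K : Type) [Field K] {ι : Type} (S : Set (ι → K)) (D : ℕ) : Prop :=
  coneKrullDim K S = ((D : ℕ∞) : WithBot ℕ∞) + 1

/-- The affine cone over the `s`-th secant variety `σ_s(X)` of the projective variety
with affine cone `C`: (the closure of) the set of sums of `s` elements of `C`.
Since `C` is a cone, sums of `s` elements of `C` are exactly the vectors lying on the
cone over the linear span of `s` points of `X`.  (Taking the Zariski closure does not
change the vanishing ideal, hence does not change the dimension.) -/
def secantCone (K : Type) [Field K] {ι : Type} (C : Set (ι → K)) (s : ℕ) : Set (ι → K) :=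
  { y | ∃ x : Fin s → (ι → K), (∀ i, x i ∈ C) ∧ y = ∑ i, x i }

/-- The affine cone over the Segre–Veronese variety `X^{(n,m)}_{(1,d)}`, the image of
`P^n × P^m` embedded by `O(1,d)` in `P^N`, `N = (n+1)·C(m+d,d) − 1`.  Coordinates of the
ambient `P^N` are indexed by pairs (coordinate of `P^n`, monomial of degree `d` in the
`m+1` coordinates of `P^m`); there are `(n+1)·C(m+d,d)` of them. -/
def svCone (K : Type) [Field K] (n m d : ℕ) :
    Set ((Fin (n + 1) × { μ : Fin (m + 1) → ℕ // ∑ i, μ i = d }) → K) :=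
  { v | ∃ (a : Fin (n + 1) → K) (b : Fin (m + 1) → K),
      v = fun p => a p.1 * ∏ i, b i ^ (p.2.1 i) }

theorem ringKrullDim_eq_of_isIntegral_of_injective {R S : Type*} [CommRing R] [CommRing S]
    [Nontrivial R] [Algebra R S] [Algebra.IsIntegral R S]
    (hinj : Function.Injective (algebraMap R S)) :
    ringKrullDim R = ringKrullDim S := by
  have : FaithfulSMul R S := (faithfulSMul_iff_algebraMap_injective R S).mpr hinj
  apply le_antisymm
  · refine iSup_le fun l => ?_
    obtain ⟨Q, -, hQ, hQl⟩ := Ideal.exists_ideal_over_prime_of_isIntegral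
      (S := S) l.head.asIdeal ⊥ (by
        rw [← RingHom.ker_eq_comap_bot, (RingHom.injective_iff_ker_eq_bot _).mp hinj]
        exact bot_le)
    have : Q.LiesOver l.head.asIdeal := ⟨hQl.symm⟩
    obtain ⟨L, hL, -⟩ := Ideal.exists_ltSeries_of_hasGoingUp l Q
    rw [← hL]
    exact Order.LTSeries.length_le_krullDim L
  · refine Order.krullDim_le_of_strictMono (PrimeSpectrum.comap (algebraMap R S)) ?_
    intro I J hIJ
    exact Ideal.IsIntegral.comap_lt_comap hIJ

theorem Derivation.eq_zero_of_aeval_eq_zero {A R : Type*} [CommRing A] [CommRing R] [IsDomain R]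
    [Algebra A R] [CharZero A] [IsDomain A] (hinj : Function.Injective (algebraMap A R))
    (D : Derivation A R R) (x : R) (P : Polynomial A) (hP : P ≠ 0)
    (hx : Polynomial.aeval x P = 0) : D x = 0 := by
  induction hk : P.natDegree using Nat.strong_induction_on generalizing P with
  | _ k ih =>
    by_cases h0 : Polynomial.aeval x (Polynomial.derivative P) = 0
    · have hdeg : P.natDegree ≠ 0 := by
        intro h
        rw [Polynomial.eq_C_of_natDegree_eq_zero h] at hx hP
        rw [Polynomial.aeval_C] at hx
        apply hP
        rw [(map_eq_zero_iff _ hinj).mp hx, map_zero]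
      refine ih _ ?_ (Polynomial.derivative P) ?_ h0 rfl
      · rw [← hk]
        exact Polynomial.natDegree_derivative_lt hdeg
      · intro h
        exact hdeg (Polynomial.derivative_eq_zero.mp h)
    · have := D.map_aeval P x
      rw [hx, map_zero] at this
      simpa [h0] using this.symm

section
variable {K : Type*} [Field K] {α ι τ : Type*} [Fintype α] [Fintype ι] [DecidableEq α]

/-- The square matrix obtained from a family of polynomial vectors by a constant change of
coordinates. -/
noncomputable def constMinor (v : α → ι → MvPolynomial τ K) (B : ι → α → K) : Matrix α α (MvPolynomial τ K) :=
  Matrix.of fun j k => ∑ i, v j i * C (B i k)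

/-- A family of polynomial vectors independent at a point has a maximal minor (up to a change of
coordinates) not vanishing at that point. -/
theorem exists_eval_det_constMinor_ne_zero (v : α → ι → MvPolynomial τ K) (p : τ → K)
    (h : LinearIndependent K (fun j i => eval p (v j i))) :
    ∃ B : ι → α → K, eval p (constMinor v B).det ≠ 0 := by
  classical
  have hinj : Function.Injective (Fintype.linearCombination K (fun j i => eval p (v j i))) :=
    linearIndependent_iff_injective_fintypeLinearCombination.mp h
  obtain ⟨g, hg⟩ := LinearMap.exists_leftInverse_of_injective _ (LinearMap.ker_eq_bot.mpr hinj)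
  refine ⟨fun i => g (Pi.single i 1), ?_⟩
  rw [RingHom.map_det]
  have : (eval p).mapMatrix (constMinor v fun i => g (Pi.single i 1)) = 1 := by
    ext j k
    have h1 := LinearMap.congr_fun hg (Pi.single j 1)
    simp only [LinearMap.comp_apply, LinearMap.id_apply,
      Fintype.linearCombination_apply_single, one_smul] at h1
    rw [LinearMap.pi_apply_eq_sum_univ g] at h1
    have h2 := congrFun h1 k
    simp only [Finset.sum_apply, Pi.smul_apply, smul_eq_mul] at h2
    simp only [constMinor, RingHom.mapMatrix_apply, Matrix.map_apply, Matrix.of_apply, map_sum,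
      map_mul, eval_C]
    have h3 : ∀ i : ι, (Pi.single i 1 : ι → K) = fun j => if i = j then 1 else 0 := by
      intro i; ext j; simp [Pi.single_apply, eq_comm]
    simp only [h3]
    rw [h2, Matrix.one_apply, Pi.single_apply]
    simp [eq_comm]
  rw [this]; simp

theorem linearIndependent_of_eval_det_constMinor_ne_zero (v : α → ι → MvPolynomial τ K)
    (B : ι → α → K) (p : τ → K) (h : eval p (constMinor v B).det ≠ 0) :
    LinearIndependent K (fun j i => eval p (v j i)) := by
  rw [Fintype.linearIndependent_iff]
  intro c hc
  rw [RingHom.map_det] at h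
  refine congrFun (Matrix.eq_zero_of_vecMul_eq_zero h ?_)
  ext k
  simp only [Matrix.vecMul, dotProduct, constMinor, RingHom.mapMatrix_apply, Matrix.map_apply,
    Matrix.of_apply, map_sum, map_mul, eval_C, Pi.zero_apply, Finset.mul_sum]
  rw [Finset.sum_comm]
  refine Finset.sum_eq_zero fun i _ => ?_
  have := congrFun hc i
  simp only [Finset.sum_apply, Pi.smul_apply, smul_eq_mul, Pi.zero_apply] at this
  simp only [← mul_assoc, ← Finset.sum_mul, this, zero_mul]

theorem linearIndependent_of_det_constMinor_ne_zero (v : α → ι → MvPolynomial τ K)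
    (B : ι → α → K) (h : (constMinor v B).det ≠ 0) :
    LinearIndependent (MvPolynomial τ K) v := by
  rw [Fintype.linearIndependent_iff]
  intro c hc
  refine congrFun (Matrix.eq_zero_of_vecMul_eq_zero h ?_)
  ext1 k
  simp only [Matrix.vecMul, dotProduct, constMinor, Matrix.of_apply, Pi.zero_apply,
    Finset.mul_sum]
  rw [Finset.sum_comm]
  refine Finset.sum_eq_zero fun i _ => ?_
  have := congrFun hc i
  simp only [Finset.sum_apply, Pi.smul_apply, smul_eq_mul, Pi.zero_apply] at this
  simp only [← mul_assoc, ← Finset.sum_mul, this, zero_mul]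

end

theorem le_of_linearIndependent_pderiv {K : Type*} [Field K] [CharZero K] {ι τ : Type*} [Fintype ι]
    {s r : ℕ} (h : MvPolynomial (Fin s) K →ₐ[K] MvPolynomial τ K) (hh : Function.Injective h)
    (φ : ι → MvPolynomial τ K) (hφ : ∀ i, (h : MvPolynomial (Fin s) K →+* _).IsIntegralElem (φ i))
    (p : τ → K) (f : Fin r → τ)
    (hf : LinearIndependent K (fun a i => eval p (pderiv (f a) (φ i)))) : r ≤ s := by
  obtain ⟨B, hB⟩ := exists_eval_det_constMinor_ne_zero (fun a i => pderiv (f a) (φ i)) p hf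
  have hli := linearIndependent_of_det_constMinor_ne_zero _ B
    (fun h0 => hB (by rw [h0, map_zero]))
  rw [Fintype.linearIndependent_iff] at hli
  by_contra hlt
  have hni := mt (card_le_of_injective (α := Fin r) (β := Fin s) (MvPolynomial τ K)
    (Fintype.linearCombination (MvPolynomial τ K)
      (fun (a : Fin r) (j : Fin s) => pderiv (f a) (h (X j))))) (by simpa using hlt)
  rw [← LinearMap.ker_eq_bot, Submodule.eq_bot_iff] at hni
  push Not at hni
  obtain ⟨c, hc, hc0⟩ := hni
  apply hc0
  rw [LinearMap.mem_ker, Fintype.linearCombination_apply] at hc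
  let D : Derivation K (MvPolynomial τ K) (MvPolynomial τ K) := ∑ a, c a • pderiv (f a)
  have hD : ∀ x, D x = ∑ a, c a * pderiv (f a) x := by
    intro x
    have := congrFun (map_sum (Derivation.coeFnAddMonoidHom
      (R := K) (A := MvPolynomial τ K) (M := MvPolynomial τ K)) (fun a => c a • pderiv (f a))
      Finset.univ) x
    rw [Finset.sum_apply] at this
    exact this
  have hDh : ∀ y, D (h y) = 0 := by
    intro y
    have e : h = aeval (fun j => h (X j)) := by
      ext j; simp
    induction y using MvPolynomial.induction_on with
    | C a => rw [← MvPolynomial.algebraMap_eq, AlgHom.commutes, Derivation.map_algebraMap]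
    | add p q hp hq => rw [map_add, map_add, hp, hq, add_zero]
    | mul_X p j hp =>
      rw [map_mul, Derivation.leibniz, hp, smul_zero, add_zero, hD]
      have := congrFun hc j
      simp only [Finset.sum_apply, Pi.smul_apply, smul_eq_mul, Pi.zero_apply] at this
      rw [this, smul_zero]
  have hDφ : ∀ i, D (φ i) = 0 := by
    intro i
    obtain ⟨P, hP, hx⟩ := hφ i
    let : Algebra (MvPolynomial (Fin s) K) (MvPolynomial τ K) := h.toRingHom.toAlgebra
    let D' : Derivation (MvPolynomial (Fin s) K) (MvPolynomial τ K) (MvPolynomial τ K) :=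
      { toFun := D
        map_add' := map_add D
        map_smul' := fun y x => by
          rw [Algebra.smul_def, Derivation.leibniz]
          have : D (algebraMap (MvPolynomial (Fin s) K) (MvPolynomial τ K) y) = 0 := hDh y
          rw [this, smul_zero, add_zero, RingHom.id_apply, Algebra.smul_def y, smul_eq_mul]
        map_one_eq_zero' := D.map_one_eq_zero
        leibniz' := D.leibniz }
    exact Derivation.eq_zero_of_aeval_eq_zero hh D' (φ i) P hP.ne_zero hx
  apply _root_.funext
  apply hli
  ext1 i
  have := hDφ i
  rw [hD] at this
  simpa using this

theorem ringKrullDim_eq_of_ringHom_isIntegral {R S : Type*} [CommRing R] [CommRing S]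
    [Nontrivial R] (g : R →+* S) (hg : Function.Injective g) (hgi : g.IsIntegral) :
    ringKrullDim R = ringKrullDim S := by
  let := g.toAlgebra
  have : Algebra.IsIntegral R S := ⟨hgi⟩
  exact ringKrullDim_eq_of_isIntegral_of_injective hg

theorem exists_ringKrullDim_of_injective {K : Type} [Field K] [CharZero K] {ι τ : Type} [Fintype ι]
    [Fintype τ] {A : Type} [CommRing A] [Algebra K A]
    (π : MvPolynomial ι K →ₐ[K] A) (hπ : Function.Surjective π)
    (ψ : A →ₐ[K] MvPolynomial τ K) (hψ : Function.Injective ψ) :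
    ∃ s : ℕ, ringKrullDim A = s ∧
      s ≤ Fintype.card τ ∧ s ≤ Fintype.card ι ∧
      ∀ (p : τ → K) (r : ℕ) (f : Fin r → τ),
        LinearIndependent K (fun a i => eval p (pderiv (f a) (ψ (π (X i))))) → r ≤ s := by
  have : Nontrivial A := ψ.toRingHom.domain_nontrivial
  have : Algebra.FiniteType K A := Algebra.FiniteType.of_surjective π hπ
  obtain ⟨s, g, hg, hgi⟩ := exists_integral_inj_algHom_of_fg K A
  have hdim : ringKrullDim A = s := by
    rw [← ringKrullDim_eq_of_ringHom_isIntegral g.toRingHom hg hgi,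
      MvPolynomial.ringKrullDim_of_isNoetherianRing, ringKrullDim_eq_zero_of_field, zero_add,
      Nat.card_eq_fintype_card, Fintype.card_fin]
  have hinj : Function.Injective (ψ.comp g) := hψ.comp hg
  refine ⟨s, hdim, ?_, ?_, ?_⟩
  · have := trdeg_le_of_injective _ hinj
    simpa [MvPolynomial.trdeg_of_isDomain] using this
  · have := ringKrullDim_le_of_surjective π.toRingHom hπ
    rw [hdim, MvPolynomial.ringKrullDim_of_isNoetherianRing] at this
    simp only [ringKrullDim_eq_zero_of_field, zero_add, Nat.card_eq_fintype_card] at this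
    exact_mod_cast this
  · intro p r f hf
    refine le_of_linearIndependent_pderiv (ψ.comp g) hinj _ (fun i => ?_) p f hf
    obtain ⟨P, hP, hx⟩ := hgi (π (X i))
    refine ⟨P, hP, ?_⟩
    have h2 := congrArg ψ hx
    rw [map_zero] at h2
    rw [← h2]
    exact (Polynomial.hom_eval₂ P g.toRingHom ψ.toRingHom _).symm

theorem exists_ringKrullDim_quotient_ker {K : Type} [Field K] [CharZero K] {ι τ : Type} [Fintype ι]
    [Fintype τ] (I : Ideal (MvPolynomial ι K)) (F : MvPolynomial ι K →ₐ[K] MvPolynomial τ K)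
    (hI : I = RingHom.ker F) :
    ∃ s : ℕ, ringKrullDim (MvPolynomial ι K ⧸ I) = s ∧
      s ≤ Fintype.card τ ∧ s ≤ Fintype.card ι ∧
      ∀ (p : τ → K) (r : ℕ) (f : Fin r → τ),
        LinearIndependent K (fun a i => eval p (pderiv (f a) (F (X i)))) → r ≤ s := by
  subst hI
  exact exists_ringKrullDim_of_injective
    (Ideal.Quotient.mkₐ K (RingHom.ker F)) (Ideal.Quotient.mkₐ_surjective K _)
    (Ideal.kerLiftAlg F) (Ideal.kerLiftAlg_injective _)

section
variable {K : Type*} [Field K] {σ : Type*}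

/-- The filter of Zariski-dense open subsets of affine space. -/
def zar (K : Type*) [Field K] (σ : Type*) : Filter (σ → K) where
  sets := {S | ∃ f : MvPolynomial σ K, f ≠ 0 ∧ ∀ p, eval p f ≠ 0 → p ∈ S}
  univ_sets := ⟨1, one_ne_zero, fun _ _ => trivial⟩
  sets_of_superset := fun ⟨f, hf, h⟩ hST => ⟨f, hf, fun p hp => hST (h p hp)⟩
  inter_sets := fun ⟨f, hf, h⟩ ⟨g, hg, h'⟩ => ⟨f * g, mul_ne_zero hf hg, fun p hp => by
    rw [map_mul] at hp
    exact ⟨h p (left_ne_zero_of_mul hp), h' p (right_ne_zero_of_mul hp)⟩⟩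

instance [Infinite K] : (zar K σ).NeBot := by
  rw [Filter.neBot_iff, Ne, ← Filter.empty_mem_iff_bot]
  rintro ⟨f, hf, h⟩
  exact hf (MvPolynomial.funext fun p => by
    by_contra hp
    exact h p (by simpa using hp))

theorem eventually_zar_eval_ne_zero (f : MvPolynomial σ K) (p₀ : σ → K) (h : eval p₀ f ≠ 0) :
    ∀ᶠ p in zar K σ, eval p f ≠ 0 :=
  ⟨f, fun h0 => h (by rw [h0, map_zero]), fun _ hp => hp⟩

theorem eventually_zar_apply_ne_zero (i : σ) : ∀ᶠ p in zar K σ, p i ≠ 0 := by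
  have := eventually_zar_eval_ne_zero (K := K) (X i) (fun _ => 1) (by simp)
  simpa using this

theorem eventually_zar_linearIndependent {α ι : Type*} [Finite α] [Finite ι]
    (v : α → ι → MvPolynomial σ K) (p₀ : σ → K)
    (h : LinearIndependent K (fun j i => eval p₀ (v j i))) :
    ∀ᶠ p in zar K σ, LinearIndependent K (fun j i => eval p (v j i)) := by
  classical
  have := Fintype.ofFinite α
  have := Fintype.ofFinite ι
  obtain ⟨B, hB⟩ := exists_eval_det_constMinor_ne_zero v p₀ h
  exact (eventually_zar_eval_ne_zero _ p₀ hB).mono fun p hp =>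
    linearIndependent_of_eval_det_constMinor_ne_zero v B p hp

/-- The rank of a family of vectors. -/
noncomputable def rk (K : Type*) [Field K] {α V : Type*} [AddCommGroup V] [Module K V] (v : α → V) : ℕ :=
  Module.finrank K (Submodule.span K (Set.range v))

theorem le_rk_of_linearIndependent {α β V : Type*} [Fintype β] [AddCommGroup V] [Module K V]
    [FiniteDimensional K V] (v : α → V) (f : β → α) (h : LinearIndependent K (v ∘ f)) :
    Fintype.card β ≤ rk K v := by
  rw [← finrank_span_eq_card h]
  exact Submodule.finrank_mono (Submodule.span_mono (Set.range_comp_subset_range f v))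

theorem exists_linearIndependent_of_le_rk {α V : Type*} [AddCommGroup V] [Module K V]
    [FiniteDimensional K V] (v : α → V) (r : ℕ) (hr : r ≤ rk K v) :
    ∃ f : Fin r → α, LinearIndependent K (v ∘ f) := by
  obtain ⟨g, hg, -, hli⟩ := Submodule.exists_fun_fin_finrank_span_eq K (Set.range v)
  choose f hf using hg
  refine ⟨fun i => f (Fin.castLE hr i), ?_⟩
  have : v ∘ (fun i => f (Fin.castLE hr i)) = g ∘ Fin.castLE hr := by
    ext1 i; simp [hf]
  rw [this]
  exact hli.comp _ (Fin.castLE_injective hr)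

theorem eventually_zar_le_rk {α ι : Type*} [Finite ι]
    (v : α → ι → MvPolynomial σ K) (p₀ : σ → K) (r : ℕ)
    (h : r ≤ rk K (fun j i => eval p₀ (v j i))) :
    ∀ᶠ p in zar K σ, r ≤ rk K (fun j i => eval p (v j i)) := by
  obtain ⟨f, hf⟩ := exists_linearIndependent_of_le_rk _ r h
  refine (eventually_zar_linearIndependent (fun a => v (f a)) p₀ hf).mono fun p hp => ?_
  simpa using le_rk_of_linearIndependent (fun j i => eval p (v j i)) f hp

/-- Adding vectors of a set one by one raises the rank until the span is exhausted. -/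
theorem exists_min_le_finrank_sup {V β : Type*} [AddCommGroup V] [Module K V]
    [FiniteDimensional K V] [Nonempty β] (T : Submodule K V) (w : β → V) (k : ℕ) :
    ∃ f : Fin k → β,
      min (Module.finrank K ↥(T ⊔ Submodule.span K (Set.range w))) (Module.finrank K T + k) ≤
      Module.finrank K ↥(T ⊔ Submodule.span K (Set.range (w ∘ f))) := by
  induction k generalizing T with
  | zero =>
    refine ⟨Fin.elim0, (min_le_right _ _).trans ?_⟩
    exact Submodule.finrank_mono le_sup_left
  | succ k ih =>
    obtain ⟨b, hb⟩ : ∃ b, min (Module.finrank K ↥(T ⊔ Submodule.span K (Set.range w)))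
        (Module.finrank K T + 1) ≤ Module.finrank K ↥(T ⊔ Submodule.span K {w b}) := by
      by_cases h : ∀ b, w b ∈ T
      · obtain ⟨b⟩ := ‹Nonempty β›
        refine ⟨b, (min_le_left _ _).trans (Submodule.finrank_mono (sup_le le_sup_left ?_))⟩
        exact (Submodule.span_le.mpr (Set.range_subset_iff.mpr h)).trans le_sup_left
      · push Not at h
        obtain ⟨b, hb⟩ := h
        refine ⟨b, (min_le_right _ _).trans (Nat.succ_le_of_lt (Submodule.finrank_lt_finrank_of_lt ?_))⟩
        refine lt_of_le_of_ne le_sup_left fun h => hb ?_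
        rw [h]
        exact Submodule.mem_sup_right (Submodule.mem_span_singleton_self _)
    obtain ⟨f, hf⟩ := ih (T ⊔ Submodule.span K {w b})
    refine ⟨Fin.cons b f, ?_⟩
    have e1 : T ⊔ Submodule.span K {w b} ⊔ Submodule.span K (Set.range w)
        = T ⊔ Submodule.span K (Set.range w) := by
      rw [sup_assoc, ← Submodule.span_union, Set.singleton_union,
        Set.insert_eq_of_mem (Set.mem_range_self b)]
    have e2 : T ⊔ Submodule.span K {w b} ⊔ Submodule.span K (Set.range (w ∘ f))
        = T ⊔ Submodule.span K (Set.range (w ∘ (Fin.cons b f : Fin (k + 1) → β))) := by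
      rw [sup_assoc, ← Submodule.span_union, Set.singleton_union, ← Fin.range_cons, Fin.comp_cons]
    rw [e1, e2] at hf
    omega

theorem linearIndependent_sumElim_of_finrank {V β α : Type*} [AddCommGroup V] [Module K V]
    [Fintype α] [Fintype β] (u : α → V) (w : β → V)
    (h : Fintype.card α + Fintype.card β ≤
      Module.finrank K ↥(Submodule.span K (Set.range u) ⊔ Submodule.span K (Set.range w))) :
    LinearIndependent K (Sum.elim u w) := by
  rw [linearIndependent_iff_card_le_finrank_span, Fintype.card_sum, Set.finrank, Set.Sum.elim_range,
    Submodule.span_union]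
  exact h
end

section
variable {K : Type*} [Field K] {σ : Type*} [Fintype σ] {d : ℕ}

/-- Exponents of monomials of degree `d`. -/
abbrev Mon (σ : Type*) [Fintype σ] (d : ℕ) := {μ : σ → ℕ // ∑ i, μ i = d}

instance : Finite (Mon σ d) := by
  classical
  exact Finite.of_equiv _ (Sym.equivNatSumOfFintype σ d)

noncomputable instance : Fintype (Mon σ d) := Fintype.ofFinite _

theorem card_mon : Fintype.card (Mon σ d) = (Fintype.card σ + d - 1).choose d := by
  classical
  rw [← Sym.card_sym_eq_choose (α := σ) d]
  exact Fintype.card_congr (Sym.equivNatSumOfFintype σ d).symm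

theorem finrank_mon : Module.finrank K (Mon σ d → K) = (Fintype.card σ + d - 1).choose d := by
  rw [Module.finrank_fintype_fun_eq_card, card_mon]

/-- The monomial with given exponents. -/
noncomputable def mon (K : Type*) [Field K] (μ : σ → ℕ) : MvPolynomial σ K := ∏ i, X i ^ μ i

/-- The values of all monomials of degree `d` at a point. -/
noncomputable def ev (d : ℕ) (p : σ → K) : Mon σ d → K := fun μ => eval p (mon K μ.1)

/-- The values of the partial derivatives of all monomials of degree `d` at a point. -/
noncomputable def tg (d : ℕ) (p : σ → K) (v : σ) : Mon σ d → K :=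
  fun μ => eval p (pderiv v (mon K μ.1))

theorem ev_apply (p : σ → K) (μ : Mon σ d) : ev d p μ = ∏ i, p i ^ μ.1 i := by
  simp [ev, mon]

theorem mon_eq_monomial (μ : σ → ℕ) :
    mon K μ = monomial (Finsupp.equivFunOnFinite.symm μ) 1 := by
  rw [monomial_eq, mon, map_one, one_mul, Finsupp.prod_fintype _ _ (by simp)]
  rfl

theorem span_range_ev [Infinite K] : Submodule.span K (Set.range (ev (K := K) (σ := σ) d)) = ⊤ := by
  classical
  by_contra h
  obtain ⟨f, hf, hfs⟩ := Submodule.exists_le_ker_of_lt_top _ (lt_top_iff_ne_top.mpr h)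
  apply hf
  have h1 : (∑ μ : Mon σ d, C (f (Pi.single μ 1)) * mon K μ.1 : MvPolynomial σ K) = 0 := by
    apply MvPolynomial.funext
    intro p
    have h2 : f (ev d p) = 0 := hfs (Submodule.subset_span ⟨p, rfl⟩)
    rw [LinearMap.pi_apply_eq_sum_univ f] at h2
    have h3 : ∀ i : Mon σ d, (Pi.single i 1 : Mon σ d → K) = fun j => if i = j then 1 else 0 := by
      intro i; ext j; simp [Pi.single_apply, eq_comm]
    simp only [map_sum, map_mul, eval_C, map_zero, h3]
    refine Eq.trans ?_ h2
    exact Finset.sum_congr rfl fun μ _ => by rw [smul_eq_mul, mul_comm]; rfl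
  refine LinearMap.pi_ext' fun μ => LinearMap.ext_ring ?_
  have h2 := congrArg (coeff (Finsupp.equivFunOnFinite.symm μ.1)) h1
  simp only [coeff_sum, coeff_C_mul, mon_eq_monomial, coeff_monomial, coeff_zero,
    EmbeddingLike.apply_eq_iff_eq, Subtype.val_inj] at h2
  simpa using h2

/-- The differential of the `d`-th Veronese map. -/
noncomputable def dv (d : ℕ) (p : σ → K) : (σ → K) →ₗ[K] (Mon σ d → K) :=
  Fintype.linearCombination K (tg d p)

theorem dv_apply (p ℓ : σ → K) : dv d p ℓ = ∑ v, ℓ v • tg d p v := by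
  simp [dv, Fintype.linearCombination_apply]

theorem dv_apply_apply (p ℓ : σ → K) (μ : Mon σ d) :
    dv d p ℓ μ = ∑ v, ℓ v * eval p (pderiv v (mon K μ.1)) := by
  simp [dv_apply, tg]

theorem dv_self (p : σ → K) : dv d p p = (d : K) • ev d p := by
  classical
  ext μ
  rw [dv_apply_apply]
  have h1 : ∀ v, eval p (X v * pderiv v (mon K μ.1)) = μ.1 v * eval p (mon K μ.1) := by
    intro v
    rw [mon_eq_monomial, X_mul_pderiv_monomial]
    simp
  simp only [map_mul, eval_X] at h1
  simp only [h1, ← Finset.sum_mul, ← Nat.cast_sum, μ.2]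
  rfl

/-- Independence of double points. -/
def IndepD (K : Type*) [Field K] {β σ : Type*} [Fintype σ] (d : ℕ) (p : β → σ → K) : Prop :=
  LinearIndependent K (fun x : β × σ => tg d (p x.1) x.2)

theorem indepD_iff {β : Type*} [Fintype β] (p : β → σ → K) :
    IndepD K d p ↔ ∀ ℓ : β → σ → K, ∑ j, dv d (p j) (ℓ j) = 0 → ∀ j, ℓ j = 0 := by
  rw [IndepD, Fintype.linearIndependent_iff]
  constructor
  · intro h ℓ hℓ j
    ext v
    refine h (fun x => ℓ x.1 x.2) ?_ (j, v)
    rw [Fintype.sum_prod_type]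
    simpa [dv_apply] using hℓ
  · intro h g hg x
    refine congrFun (h (fun j v => g (j, v)) ?_ x.1) x.2
    rw [Fintype.sum_prod_type] at hg
    simpa [dv_apply] using hg

/-! ### Restriction to a coordinate hyperplane and contraction by its equation -/

/-- Extension by zero of an exponent. -/
def Mon.extend (μ : Mon σ d) : Mon (Option σ) d :=
  ⟨fun o => o.elim 0 μ.1, by rw [Fintype.sum_option]; simpa using μ.2⟩

/-- Multiplication of a monomial by the distinguished variable. -/
def Mon.mulNone [DecidableEq σ] (μ : Mon (Option σ) d) : Mon (Option σ) (d + 1) :=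
  ⟨μ.1 + Pi.single none 1, by simp [Finset.sum_add_distrib, μ.2]⟩

/-- Contraction by the distinguished variable. -/
def contr (K : Type*) [Field K] (σ) [Fintype σ] [DecidableEq σ] (d : ℕ) :
    (Mon (Option σ) (d + 1) → K) →ₗ[K] (Mon (Option σ) d → K) :=
  LinearMap.funLeft K K Mon.mulNone

/-- Restriction to the hyperplane where the distinguished variable vanishes. -/
def restr (K : Type*) [Field K] (σ) [Fintype σ] (d : ℕ) :
    (Mon (Option σ) d → K) →ₗ[K] (Mon σ d → K) :=
  LinearMap.funLeft K K Mon.extend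


theorem mon_mulNone [DecidableEq σ] (μ : Mon (Option σ) d) :
    mon K μ.mulNone.1 = mon K μ.1 * X none := by
  simp only [mon, Mon.mulNone, Pi.add_apply, pow_add, Finset.prod_mul_distrib]
  congr 1
  rw [Finset.prod_eq_single none]
  · simp
  · intro b _ hb; simp [hb]
  · simp

theorem mon_extend (μ : Mon σ d) : mon K μ.extend.1 = rename some (mon K μ.1) := by
  simp [mon, Mon.extend, Fintype.prod_option]

theorem contr_ev [DecidableEq σ] (p : Option σ → K) :
    contr K σ d (ev (d + 1) p) = p none • ev d p := by
  ext μ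
  simp [contr, LinearMap.funLeft_apply, ev, mon_mulNone, mul_comm]

theorem contr_dv [DecidableEq σ] (p ℓ : Option σ → K) :
    contr K σ d (dv (d + 1) p ℓ) = ℓ none • ev d p + p none • dv d p ℓ := by
  ext μ
  simp only [contr, LinearMap.funLeft_apply, dv_apply_apply, mon_mulNone, Derivation.leibniz,
    pderiv_X, map_add, smul_eq_mul, map_mul, eval_X, mul_add, Finset.sum_add_distrib,
    Pi.add_apply, Pi.smul_apply, Finset.mul_sum]
  congr 1
  · rw [Finset.sum_eq_single none]
    · simp [ev]
    · intro b _ hb; simp [hb]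
    · simp
  · exact Finset.sum_congr rfl fun v _ => by ring

theorem contr_dv_eq [CharZero K] [DecidableEq σ] (hd : d ≠ 0) (p ℓ : Option σ → K) :
    contr K σ d (dv (d + 1) p ℓ) = dv d p ((ℓ none / d) • p + p none • ℓ) := by
  have hd' : (d : K) ≠ 0 := Nat.cast_ne_zero.mpr hd
  rw [contr_dv, map_add, map_smul, map_smul, dv_self, smul_smul, div_mul_cancel₀ _ hd']

theorem restr_dv (p ℓ : Option σ → K) :
    restr K σ d (dv d p ℓ) = dv d (p ∘ some) (ℓ ∘ some) := by
  classical
  ext μ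
  simp only [restr, LinearMap.funLeft_apply, dv_apply_apply, mon_extend, Fintype.sum_option]
  have h0 : pderiv none (rename some (mon K μ.1)) = 0 := by
    apply pderiv_eq_zero_of_notMem_vars
    intro h
    have := vars_rename _ _ h
    simp at this
  rw [h0, map_zero, mul_zero, zero_add]
  refine Finset.sum_congr rfl fun v _ => ?_
  rw [pderiv_rename (Option.some_injective σ), eval_rename]
  rfl

theorem restr_ev (p : Option σ → K) : restr K σ d (ev d p) = ev d (p ∘ some) := by
  ext μ
  simp [restr, LinearMap.funLeft_apply, ev, mon_extend, eval_rename]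

end

section
variable {K : Type*} [Field K] {σ β : Type*} [Fintype σ] {d : ℕ}

/-- The span of the tangent spaces at the Veronese images of some points. -/
def dspan (d : ℕ) (p : β → σ → K) : Submodule K (Mon σ d → K) :=
  Submodule.span K (Set.range fun x : β × σ => tg d (p x.1) x.2)

theorem dv_mem_dspan (p : β → σ → K) (j : β) (ℓ : σ → K) : dv d (p j) ℓ ∈ dspan d p := by
  rw [dv_apply]
  exact Submodule.sum_mem _ fun v _ => Submodule.smul_mem _ _ (Submodule.subset_span ⟨(j, v), rfl⟩)

theorem dspan_le {p : β → σ → K} {S : Submodule K (Mon σ d → K)}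
    (h : ∀ j ℓ, dv d (p j) ℓ ∈ S) : dspan d p ≤ S := by
  classical
  refine Submodule.span_le.mpr ?_
  rintro _ ⟨⟨j, v⟩, rfl⟩
  have := h j (Pi.single v 1)
  simpa [dv] using this

theorem ev_eq_dv [CharZero K] (hd : d ≠ 0) (p : σ → K) : ev d p = dv d p ((d : K)⁻¹ • p) := by
  have hd' : (d : K) ≠ 0 := Nat.cast_ne_zero.mpr hd
  rw [map_smul, dv_self, smul_smul, inv_mul_cancel₀ hd', one_smul]

theorem ev_mem_dspan [CharZero K] (hd : d ≠ 0) (p : β → σ → K) (j : β) :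
    ev d (p j) ∈ dspan d p := by
  rw [ev_eq_dv hd]
  exact dv_mem_dspan p j _

theorem IndepD.comp {β' : Type*} {p : β → σ → K} (h : IndepD K d p) (f : β' → β)
    (hf : Function.Injective f) : IndepD K d (p ∘ f) :=
  LinearIndependent.comp h (Prod.map f id) (hf.prodMap Function.injective_id)

theorem IndepD.finrank_dspan [Fintype β] {p : β → σ → K} (h : IndepD K d p) :
    Module.finrank K (dspan d p) = Fintype.card β * Fintype.card σ := by
  rw [dspan, finrank_span_eq_card h, Fintype.card_prod]

/-! ### Genericity -/

/-- Polynomials computing `tg` at a point of a configuration. -/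
noncomputable def tgPoly (K : Type*) [Field K] {σ β : Type*} [Fintype σ] (d : ℕ) (j : β) (v : σ)
    (μ : Mon σ d) : MvPolynomial (β × σ) K :=
  rename (Prod.mk j) (pderiv v (mon K μ.1))

/-- Polynomials computing `ev` at a point of a configuration. -/
noncomputable def evPoly (K : Type*) [Field K] {σ β : Type*} [Fintype σ] (d : ℕ) (j : β)
    (μ : Mon σ d) : MvPolynomial (β × σ) K :=
  rename (Prod.mk j) (mon K μ.1)

theorem eval_tgPoly (p : β × σ → K) (j : β) (v : σ) (μ : Mon σ d) :
    eval p (tgPoly K d j v μ) = tg d (fun w => p (j, w)) v μ := by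
  rw [tgPoly, eval_rename]; rfl

theorem eval_evPoly (p : β × σ → K) (j : β) (μ : Mon σ d) :
    eval p (evPoly K d j μ) = ev d (fun w => p (j, w)) μ := by
  rw [evPoly, eval_rename]; rfl

theorem eventually_indepD [Finite β] (p₀ : β → σ → K) (h : IndepD K d p₀) :
    ∀ᶠ p in zar K (β × σ), IndepD K d (fun j v => p (j, v)) := by
  have := eventually_zar_linearIndependent (K := K) (fun x : β × σ => tgPoly K d x.1 x.2)
    (fun x => p₀ x.1 x.2) (by simp only [eval_tgPoly]; exact h)
  simp only [eval_tgPoly] at this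
  exact this

theorem eventually_le_finrank_dspan [Finite β] (p₀ : β → σ → K) (r : ℕ)
    (h : r ≤ Module.finrank K (dspan d p₀)) :
    ∀ᶠ p in zar K (β × σ), r ≤ Module.finrank K (dspan d (fun j v => p (j, v))) := by
  have := eventually_zar_le_rk (K := K) (fun x : β × σ => tgPoly K d x.1 x.2)
    (fun x => p₀ x.1 x.2) r (by simp only [eval_tgPoly]; exact h)
  simp only [eval_tgPoly] at this
  exact this

/-- Some `q` double points impose independent conditions in degree `d`. -/
def Good (K : Type*) [Field K] (σ : Type*) [Fintype σ] (d q : ℕ) : Prop :=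
  ∃ p : Fin q → σ → K, IndepD K d p

theorem Good.mono {q q' : ℕ} (h : Good K σ d q) (hq : q' ≤ q) : Good K σ d q' := by
  obtain ⟨p, hp⟩ := h
  exact ⟨p ∘ Fin.castLE hq, hp.comp _ (Fin.castLE_injective hq)⟩

theorem good_of_indepD [Fintype β] {p : β → σ → K} (h : IndepD K d p) (q : ℕ)
    (hq : q ≤ Fintype.card β) : Good K σ d q := by
  refine Good.mono ⟨p ∘ (Fintype.equivFin β).symm, h.comp _ (Equiv.injective _)⟩ hq

/-- Some `e` double points span a space of dimension at least `D` in degree `d`. -/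
def RankGE (K : Type*) [Field K] (σ : Type*) [Fintype σ] (d e D : ℕ) : Prop :=
  ∃ p : Fin e → σ → K, D ≤ Module.finrank K (dspan d p)

omit [Fintype σ] in
theorem exists_twist [CharZero K] (hd : d ≠ 0) (r ℓ' : Option σ → K) (hr : r none ≠ 0) :
    ∃ ℓ : Option σ → K, (ℓ none / d) • r + r none • ℓ = ℓ' := by
  have hd' : (d : K) ≠ 0 := Nat.cast_ne_zero.mpr hd
  have hd1 : (d : K) + 1 ≠ 0 := by exact_mod_cast Nat.succ_ne_zero d
  refine ⟨fun o => (ℓ' o - ℓ' none / (r none * (1 + d)) * r o) / r none, ?_⟩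
  ext o
  simp only [Pi.add_apply, Pi.smul_apply, smul_eq_mul]
  rw [add_comm] at hd1
  field_simp
  ring

omit [Fintype σ] in
theorem eq_zero_of_twist [CharZero K] (hd : d ≠ 0) (r ℓ : Option σ → K) (hr : r none ≠ 0)
    (h : (ℓ none / d) • r + r none • ℓ = 0) : ℓ = 0 := by
  have hd' : (d : K) ≠ 0 := Nat.cast_ne_zero.mpr hd
  have hd1 : (1 : K) + d ≠ 0 := by rw [add_comm]; exact_mod_cast Nat.succ_ne_zero d
  have h0 : ℓ none = 0 := by
    have := congrFun h none
    simp only [Pi.add_apply, Pi.smul_apply, smul_eq_mul, Pi.zero_apply] at this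
    field_simp at this
    rw [mul_zero] at this
    exact (mul_eq_zero.mp ((mul_eq_zero.mp this).resolve_right hd1)).resolve_right hr
  rw [h0, zero_div, zero_smul, zero_add] at h
  exact (smul_eq_zero.mp h).resolve_left hr

/-- The point of the hyperplane with given coordinates. -/
def hpt (x : σ → K) : Option σ → K := fun o => o.elim 0 x

theorem finrank_contr_hyperplane [CharZero K] [DecidableEq σ] (hd : d ≠ 0)
    (R : β → Option σ → K) (hR : ∀ j, R j none ≠ 0) :
    Module.finrank K (dspan d R) + (Fintype.card σ + d).choose (d + 1) ≤
      Module.finrank K ↥(dspan (d + 1) R ⊔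
        Submodule.span K (Set.range fun x : σ → K => ev (d + 1) (hpt x))) := by
  set U := Submodule.span K (Set.range fun x : σ → K => ev (d + 1) (hpt x))
  set W := dspan (d + 1) R ⊔ U
  have h1 : dspan d R ≤ W.map (contr K σ d) := by
    refine dspan_le fun j ℓ' => ?_
    obtain ⟨ℓ, hℓ⟩ := exists_twist hd (R j) ℓ' (hR j)
    refine ⟨dv (d + 1) (R j) ℓ, Submodule.mem_sup_left (dv_mem_dspan _ _ _), ?_⟩
    rw [contr_dv_eq hd, hℓ]
  have h2 : U ≤ LinearMap.ker (contr K σ d) := by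
    refine Submodule.span_le.mpr ?_
    rintro _ ⟨x, rfl⟩
    simp [LinearMap.mem_ker, contr_ev, hpt]
  have h3 : (Fintype.card σ + d).choose (d + 1) ≤ Module.finrank K U := by
    have e : U.map (restr K σ (d + 1)) = ⊤ := by
      rw [← span_range_ev (K := K), Submodule.map_span, ← Set.range_comp]
      congr 2
      ext1 x
      simp only [Function.comp_apply, restr_ev]
      rfl
    have := Submodule.finrank_map_le (restr K σ (d + 1)) U
    rwa [e, finrank_top, finrank_mon] at this
  have h4 : Module.finrank K W = Module.finrank K (W.map (contr K σ d)) +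
      Module.finrank K ↥(LinearMap.ker ((contr K σ d).domRestrict W)) := by
    rw [← LinearMap.finrank_range_add_finrank_ker ((contr K σ d).domRestrict W),
      LinearMap.range_domRestrict]
  have h5 : Module.finrank K U ≤ Module.finrank K ↥(LinearMap.ker ((contr K σ d).domRestrict W)) := by
    let f : U →ₗ[K] ↥(LinearMap.ker ((contr K σ d).domRestrict W)) :=
      LinearMap.codRestrict _ (Submodule.inclusion (le_sup_right : U ≤ W)) (fun u => h2 u.2)
    refine LinearMap.finrank_le_finrank_of_injective (f := f) ?_
    intro a b hab
    exact Subtype.ext (congrArg (fun z => (z.1.1 : Mon (Option σ) (d + 1) → K)) hab)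
  have h6 := Submodule.finrank_mono h1
  omega

/-- The differential Horace lemma, with the residual points on the hyperplane in general position. -/
theorem good_horace [CharZero K] (hd : d ≠ 0) {k e D : ℕ} (h1 : Good K σ (d + 2) k)
    (h2 : Good K (Option σ) (d + 1) e) (h3 : RankGE K (Option σ) d e D)
    (h : e * (Fintype.card σ + 1) + k ≤ (Fintype.card σ + d).choose (d + 1) + D) :
    Good K (Option σ) (d + 2) (e + k) := by
  classical
  obtain ⟨p₁, hp₁⟩ := h1
  obtain ⟨p₂, hp₂⟩ := h2
  obtain ⟨p₃, hp₃⟩ := h3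
  have hz : ∀ᶠ p in zar K (Fin e × Option σ), ∀ j, p (j, none) ≠ 0 :=
    Filter.eventually_all.mpr fun j => eventually_zar_apply_ne_zero (j, none)
  obtain ⟨R', ⟨hR1, hR2⟩, hR3⟩ := (((eventually_indepD p₂ hp₂).and
    (eventually_le_finrank_dspan p₃ D hp₃)).and hz).exists
  set R : Fin e → Option σ → K := fun j v => R' (j, v)
  obtain ⟨f, hf⟩ := exists_min_le_finrank_sup (dspan (d + 1) R)
    (fun x : σ → K => ev (d + 1) (hpt x)) k
  have hfr := finrank_contr_hyperplane hd R hR3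
  have hT := hR1.finrank_dspan
  simp only [Fintype.card_fin, Fintype.card_option] at hT
  have hli : LinearIndependent K (Sum.elim (fun x : Fin e × Option σ => tg (d + 1) (R x.1) x.2)
      (fun i : Fin k => ev (d + 1) (hpt (f i)))) := by
    apply linearIndependent_sumElim_of_finrank
    simp only [Fintype.card_prod, Fintype.card_fin, Fintype.card_option]
    refine le_trans ?_ hf
    rw [le_min_iff]
    exact ⟨by omega, by omega⟩
  have hopen := eventually_zar_linearIndependent (K := K) (σ := Fin k × σ)
    (Sum.elim (fun (x : Fin e × Option σ) (μ : Mon (Option σ) (d + 1)) =>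
        C (tg (d + 1) (R x.1) x.2 μ))
      (fun (i : Fin k) (μ : Mon (Option σ) (d + 1)) =>
        ∏ o : Option σ, (o.elim 0 fun v => X (i, v)) ^ μ.1 o))
    (fun x => f x.1 x.2) (by
      convert hli using 1
      ext x μ
      rcases x with x | i
      · simp
      · simp [ev_apply, hpt, Fintype.prod_option])
  obtain ⟨x, hx1, hx2⟩ := (hopen.and (eventually_indepD p₁ hp₁)).exists
  have hx1' : LinearIndependent K (Sum.elim (fun x : Fin e × Option σ => tg (d + 1) (R x.1) x.2)
      (fun i : Fin k => ev (d + 1) (hpt fun v => x (i, v)))) := by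
    convert hx1 using 1
    ext y μ
    rcases y with y | i
    · simp
    · simp [ev_apply, hpt, Fintype.prod_option]
  have hfin : IndepD K (d + 2) (Sum.elim R fun i => hpt fun v => x (i, v)) := by
    rw [indepD_iff]
    intro ℓ hℓ
    simp only [Fintype.sum_sum_type, Sum.elim_inl, Sum.elim_inr] at hℓ
    have hc := congrArg (contr K σ (d + 1)) hℓ
    simp only [map_add, map_sum, map_zero] at hc
    simp only [contr_dv_eq (Nat.succ_ne_zero d) (R _)] at hc
    simp only [contr_dv (d := d + 1), hpt, Option.elim, zero_smul, add_zero] at hc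
    rw [Fintype.linearIndependent_iff] at hx1'
    have key := hx1' (Sum.elim
      (fun y => ((ℓ (Sum.inl y.1) none / ((d + 1 : ℕ) : K)) • R y.1 +
        R y.1 none • ℓ (Sum.inl y.1)) y.2) (fun i => ℓ (Sum.inr i) none)) (by
      rw [Fintype.sum_sum_type, Fintype.sum_prod_type]
      simp only [Sum.elim_inl, Sum.elim_inr, ← dv_apply]
      exact hc)
    have hL : ∀ j, ℓ (Sum.inl j) = 0 := fun j =>
      eq_zero_of_twist (Nat.succ_ne_zero d) (R j) _ (hR3 j)
        (_root_.funext fun v => key (Sum.inl (j, v)))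
    have hr := congrArg (restr K σ (d + 2)) hℓ
    simp only [map_sum, map_zero, hL, Finset.sum_const_zero, zero_add, restr_dv] at hr
    rw [indepD_iff] at hx2
    have hlam := hx2 (fun i => ℓ (Sum.inr i) ∘ some) hr
    rintro (j | i)
    · exact hL j
    · ext o
      rcases o with _ | v
      · exact key (Sum.inr i)
      · exact congrFun (hlam i) v
  exact good_of_indepD hfin _ (by simp)
end

section
variable {K : Type*} [Field K]

/-- Coefficients of the points attached to a group of three variables. -/
def wt (K : Type*) [Field K] (a : ℕ) (i : Fin 3) : K := if a = 1 ∧ i = 2 then -1 else 1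

/-- The linear system coming from squarefree monomials involving three groups of variables
has only the trivial solution. -/
def TripleCond (u₁ v₁ u₂ v₂ u₃ v₃ : Fin 3 → Fin 3 → K) : Prop :=
  ∀ x y z : Fin 3 → Fin 3 → K,
    (∀ a b c, ∑ i, (u₁ i a * v₁ i b * x i c + u₂ i a * v₂ i c * y i b + u₃ i b * v₃ i c * z i a) = 0) →
    ∀ i a, x i a = 0 ∧ y i a = 0 ∧ z i a = 0

/-- The linear system coming from squarefree monomials involving two groups of variables
has only the trivial solution. -/
def PairCond {r : ℕ} (u v : Fin 3 → Fin 3 → K) (ζ : Fin 3 → Fin r → K) : Prop :=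
  ∀ (x y : Fin 3 → Fin 3 → K) (z : Fin 3 → Fin r → K) (s t : Fin r → Fin 3 → K),
    (∀ i i' j, i < i' →
      ∑ c, (u c i' * v c j * x c i + u c i * v c j * x c i' + u c i * u c i' * y c j)
        + ∑ a : Fin r, wt K a i * wt K a i' * s a j = 0) →
    (∀ i i' j, i < i' →
      ∑ c, (v c i' * u c j * y c i + v c i * u c j * y c i' + v c i * v c i' * x c j)
        + ∑ a : Fin r, wt K a i * wt K a i' * t a j = 0) →
    (∀ i j a, ∑ c, (u c i * v c j * z c a + u c i * ζ c a * y c j + v c j * ζ c a * x c i)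
        + wt K a i * s a j + wt K a j * t a i = 0) →
    (∀ c i, x c i = 0 ∧ y c i = 0) ∧ (∀ c a, z c a = 0) ∧ ∀ a i, s a i = 0 ∧ t a i = 0

theorem exists_tripleCond [CharZero K] :
    ∃ u₁ v₁ u₂ v₂ u₃ v₃ : Fin 3 → Fin 3 → K, TripleCond u₁ v₁ u₂ v₂ u₃ v₃ := by
  refine ⟨![![0,1,0],![0,1,-1],![0,0,1]], ![![1,-1,0],![1,0,0],![0,1,1]],
    ![![1,0,0],![1,0,0],![0,1,1]], ![![0,1,0],![1,0,-1],![0,1,0]],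
    ![![1,0,-1],![0,0,1],![0,1,0]], ![![1,0,0],![1,0,1],![0,0,1]], ?_⟩
  intro x y z h
  simp [Fin.forall_fin_succ, Fin.sum_univ_succ] at h ⊢
  grind

set_option maxHeartbeats 2000000 in
theorem exists_pairCond [CharZero K] (r : ℕ) (hr : r < 3) :
    ∃ (u v : Fin 3 → Fin 3 → K) (ζ : Fin 3 → Fin r → K), PairCond u v ζ := by
  interval_cases r
  · refine ⟨![![1,0,1],![1,-1,0],![0,1,1]], ![![1,1,0],![-1,0,-1],![0,-1,-1]], ![![],![],![]], ?_⟩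
    intro x y z s t h1 h2 h3
    simp [Fin.forall_fin_succ, Fin.sum_univ_succ, wt] at h1 h2 h3 ⊢
    grind
  · refine ⟨![![-1,0,1],![0,-1,1],![-1,-1,0]], ![![-1,0,-1],![0,1,-1],![1,1,0]],
      ![![0],![0],![-1]], ?_⟩
    intro x y z s t h1 h2 h3
    simp [Fin.forall_fin_succ, Fin.sum_univ_succ, wt] at h1 h2 h3 ⊢
    grind
  · refine ⟨![![-1,1,0],![-1,0,1],![0,1,1]], ![![-1,-1,0],![0,-1,1],![-1,0,-1]],
      ![![-1,0],![0,0],![0,1]], ?_⟩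
    intro x y z s t h1 h2 h3
    simp [Fin.forall_fin_succ, Fin.sum_univ_succ, wt] at h1 h2 h3 ⊢
    grind (splits := 50)
end

section
variable {K : Type*} [Field K]

theorem eventually_system {σ J ι : Type*} [Fintype J] [Finite ι] (c : J → ι → MvPolynomial σ K)
    (p₀ : σ → K) (h : ∀ x : J → K, (∀ i, ∑ j, x j * eval p₀ (c j i) = 0) → ∀ j, x j = 0) :
    ∀ᶠ p in zar K σ, ∀ x : J → K, (∀ i, ∑ j, x j * eval p (c j i) = 0) → ∀ j, x j = 0 := by
  have key : ∀ p : σ → K, LinearIndependent K (fun j i => eval p (c j i)) ↔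
      ∀ x : J → K, (∀ i, ∑ j, x j * eval p (c j i) = 0) → ∀ j, x j = 0 := by
    intro p
    rw [Fintype.linearIndependent_iff]
    refine forall_congr' fun x => ?_
    rw [funext_iff]
    simp
  simp only [← key] at h ⊢
  exact eventually_zar_linearIndependent c p₀ h

/-- Parameters of the points attached to pairs of groups of variables. -/
abbrev Par (G r : ℕ) := Fin G × Fin G × Fin 3 × (Fin 3 ⊕ Fin 3 ⊕ Fin r)

variable {G r : ℕ}

theorem eventually_tripleCond [CharZero K] {g h k : Fin G} (hgh : g < h) (hhk : h < k) :
    ∀ᶠ p in zar K (Par G r), TripleCond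
      (fun i a => p (g, h, i, Sum.inl a)) (fun i a => p (g, h, i, Sum.inr (Sum.inl a)))
      (fun i a => p (g, k, i, Sum.inl a)) (fun i a => p (g, k, i, Sum.inr (Sum.inl a)))
      (fun i a => p (h, k, i, Sum.inl a)) (fun i a => p (h, k, i, Sum.inr (Sum.inl a))) := by
  let U (q : Fin G × Fin G) (i a : Fin 3) : MvPolynomial (Par G r) K := X (q.1, q.2, i, Sum.inl a)
  let V (q : Fin G × Fin G) (i a : Fin 3) : MvPolynomial (Par G r) K :=
    X (q.1, q.2, i, Sum.inr (Sum.inl a))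
  let c : (Fin 3 × Fin 3) ⊕ (Fin 3 × Fin 3) ⊕ (Fin 3 × Fin 3) → Fin 3 × Fin 3 × Fin 3 →
      MvPolynomial (Par G r) K := fun j q => Sum.elim
        (fun l => if q.2.2 = l.2 then U (g, h) l.1 q.1 * V (g, h) l.1 q.2.1 else 0)
        (Sum.elim (fun l => if q.2.1 = l.2 then U (g, k) l.1 q.1 * V (g, k) l.1 q.2.2 else 0)
        (fun l => if q.1 = l.2 then U (h, k) l.1 q.2.1 * V (h, k) l.1 q.2.2 else 0)) j
  have hc : ∀ p (x : (Fin 3 × Fin 3) ⊕ (Fin 3 × Fin 3) ⊕ (Fin 3 × Fin 3) → K) (a b e : Fin 3),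
      ∑ j, x j * eval p (c j (a, b, e)) =
      ∑ i, (p (g, h, i, Sum.inl a) * p (g, h, i, Sum.inr (Sum.inl b)) * x (Sum.inl (i, e)) +
        p (g, k, i, Sum.inl a) * p (g, k, i, Sum.inr (Sum.inl e)) * x (Sum.inr (Sum.inl (i, b))) +
        p (h, k, i, Sum.inl b) * p (h, k, i, Sum.inr (Sum.inl e)) *
          x (Sum.inr (Sum.inr (i, a)))) := by
    intro p x a b e
    simp only [Fintype.sum_sum_type, Sum.elim_inl, Sum.elim_inr, c, Fintype.sum_prod_type,
      apply_ite (eval p), map_zero, mul_ite, mul_zero, Finset.sum_ite_eq, Finset.mem_univ, if_true,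
      Finset.sum_add_distrib, U, V, map_mul, eval_X]
    simp only [mul_comm (x _), add_assoc]
  obtain ⟨u₁, v₁, u₂, v₂, u₃, v₃, hT⟩ := exists_tripleCond (K := K)
  let D (u v : Fin 3 → Fin 3 → K) (q : Fin 3 × (Fin 3 ⊕ Fin 3 ⊕ Fin r)) : K :=
    Sum.elim (u q.1) (Sum.elim (v q.1) fun _ => 0) q.2
  refine (eventually_system c (fun q => if q.1 = g then (if q.2.1 = h then D u₁ v₁ q.2.2 else
    D u₂ v₂ q.2.2) else D u₃ v₃ q.2.2) ?_).mono ?_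
  · intro x hx
    have := hT (fun i a => x (Sum.inl (i, a))) (fun i a => x (Sum.inr (Sum.inl (i, a))))
      (fun i a => x (Sum.inr (Sum.inr (i, a)))) (by
        intro a b e
        have := hx (a, b, e)
        rw [hc] at this
        simpa only [if_true, if_neg hgh.ne', if_neg hhk.ne', D, Sum.elim_inl, Sum.elim_inr] using this)
    rintro (⟨i, a⟩ | ⟨i, a⟩ | ⟨i, a⟩)
    exacts [(this i a).1, (this i a).2.1, (this i a).2.2]
  · intro p hp x y z hxyz
    have := hp (Sum.elim (fun l => x l.1 l.2) (Sum.elim (fun l => y l.1 l.2) fun l => z l.1 l.2))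
      (fun q => by rw [hc]; exact hxyz _ _ _)
    exact fun i a => ⟨this (Sum.inl (i, a)), this (Sum.inr (Sum.inl (i, a))),
      this (Sum.inr (Sum.inr (i, a)))⟩

set_option maxHeartbeats 1000000 in
theorem eventually_pairCond [CharZero K] (hr : r < 3) (g h : Fin G) :
    ∀ᶠ p in zar K (Par G r), PairCond
      (fun i a => p (g, h, i, Sum.inl a)) (fun i a => p (g, h, i, Sum.inr (Sum.inl a)))
      (fun i a => p (g, h, i, Sum.inr (Sum.inr a))) := by
  let U (i a : Fin 3) : MvPolynomial (Par G r) K := X (g, h, i, Sum.inl a)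
  let V (i a : Fin 3) : MvPolynomial (Par G r) K := X (g, h, i, Sum.inr (Sum.inl a))
  let Z (i : Fin 3) (a : Fin r) : MvPolynomial (Par G r) K := X (g, h, i, Sum.inr (Sum.inr a))
  let J := (Fin 3 × Fin 3) ⊕ (Fin 3 × Fin 3) ⊕ (Fin 3 × Fin r) ⊕ (Fin r × Fin 3) ⊕ (Fin r × Fin 3)
  let I := {q : Fin 3 × Fin 3 // q.1 < q.2} × Fin 3
  let c : J → I ⊕ I ⊕ (Fin 3 × Fin 3 × Fin r) → MvPolynomial (Par G r) K :=
    fun j q => Sum.elim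
      (fun q => Sum.elim (fun l => (if q.1.1.1 = l.2 then U l.1 q.1.1.2 * V l.1 q.2 else 0) +
          (if q.1.1.2 = l.2 then U l.1 q.1.1.1 * V l.1 q.2 else 0))
        (Sum.elim (fun l => if q.2 = l.2 then U l.1 q.1.1.1 * U l.1 q.1.1.2 else 0)
        (Sum.elim (fun _ => 0)
        (Sum.elim (fun l => if q.2 = l.2 then C (wt K l.1 q.1.1.1 * wt K l.1 q.1.1.2) else 0)
        fun _ => 0))) j)
      (Sum.elim (fun q => Sum.elim
          (fun l => if q.2 = l.2 then V l.1 q.1.1.1 * V l.1 q.1.1.2 else 0)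
        (Sum.elim (fun l => (if q.1.1.1 = l.2 then V l.1 q.1.1.2 * U l.1 q.2 else 0) +
          (if q.1.1.2 = l.2 then V l.1 q.1.1.1 * U l.1 q.2 else 0))
        (Sum.elim (fun _ => 0)
        (Sum.elim (fun _ => 0)
        fun l => if q.2 = l.2 then C (wt K l.1 q.1.1.1 * wt K l.1 q.1.1.2) else 0))) j)
      fun q => Sum.elim (fun l => if q.1 = l.2 then V l.1 q.2.1 * Z l.1 q.2.2 else 0)
        (Sum.elim (fun l => if q.2.1 = l.2 then U l.1 q.1 * Z l.1 q.2.2 else 0)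
        (Sum.elim (fun l => if q.2.2 = l.2 then U l.1 q.1 * V l.1 q.2.1 else 0)
        (Sum.elim
          (fun l => if q.2.2 = l.1 then if q.2.1 = l.2 then C (wt K l.1 q.1) else 0 else 0)
          fun l => if q.2.2 = l.1 then if q.1 = l.2 then C (wt K l.1 q.2.1) else 0 else 0))) j) q
  have hc1 : ∀ p (x : J → K) (i i' j : Fin 3) (hi : i < i'),
      ∑ l, x l * eval p (c l (Sum.inl (⟨(i, i'), hi⟩, j))) =
      ∑ c, (p (g, h, c, Sum.inl i') * p (g, h, c, Sum.inr (Sum.inl j)) * x (Sum.inl (c, i)) +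
        p (g, h, c, Sum.inl i) * p (g, h, c, Sum.inr (Sum.inl j)) * x (Sum.inl (c, i')) +
        p (g, h, c, Sum.inl i) * p (g, h, c, Sum.inl i') * x (Sum.inr (Sum.inl (c, j)))) +
      ∑ a : Fin r, wt K a i * wt K a i' * x (Sum.inr (Sum.inr (Sum.inr (Sum.inl (a, j))))) := by
    intro p x i i' j hi
    simp only [J, Fintype.sum_sum_type, Sum.elim_inl, Sum.elim_inr, c, Fintype.sum_prod_type,
      apply_ite (eval p), map_zero, map_add, mul_add, mul_ite, mul_zero, Finset.sum_ite_eq,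
      Finset.mem_univ, if_true, Finset.sum_add_distrib, U, V, map_mul, eval_X, eval_C,
      Finset.sum_const_zero, add_zero, zero_add]
    simp only [mul_comm (x _), add_assoc]
  have hc2 : ∀ p (x : J → K) (i i' j : Fin 3) (hi : i < i'),
      ∑ l, x l * eval p (c l (Sum.inr (Sum.inl (⟨(i, i'), hi⟩, j)))) =
      ∑ c, (p (g, h, c, Sum.inr (Sum.inl i')) * p (g, h, c, Sum.inl j) *
          x (Sum.inr (Sum.inl (c, i))) +
        p (g, h, c, Sum.inr (Sum.inl i)) * p (g, h, c, Sum.inl j) * x (Sum.inr (Sum.inl (c, i'))) +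
        p (g, h, c, Sum.inr (Sum.inl i)) * p (g, h, c, Sum.inr (Sum.inl i')) * x (Sum.inl (c, j))) +
      ∑ a : Fin r, wt K a i * wt K a i' * x (Sum.inr (Sum.inr (Sum.inr (Sum.inr (a, j))))) := by
    intro p x i i' j hi
    simp only [J, Fintype.sum_sum_type, Sum.elim_inl, Sum.elim_inr, c, Fintype.sum_prod_type,
      apply_ite (eval p), map_zero, map_add, mul_add, mul_ite, mul_zero, Finset.sum_ite_eq,
      Finset.mem_univ, if_true, Finset.sum_add_distrib, U, V, map_mul, eval_X, eval_C,
      Finset.sum_const_zero, zero_add]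
    simp only [mul_comm (x _)]
    ring
  have hc3 : ∀ p (x : J → K) (i j : Fin 3) (a : Fin r),
      ∑ l, x l * eval p (c l (Sum.inr (Sum.inr (i, j, a)))) =
      ∑ c, (p (g, h, c, Sum.inl i) * p (g, h, c, Sum.inr (Sum.inl j)) *
          x (Sum.inr (Sum.inr (Sum.inl (c, a)))) +
        p (g, h, c, Sum.inl i) * p (g, h, c, Sum.inr (Sum.inr a)) * x (Sum.inr (Sum.inl (c, j))) +
        p (g, h, c, Sum.inr (Sum.inl j)) * p (g, h, c, Sum.inr (Sum.inr a)) * x (Sum.inl (c, i))) +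
      wt K a i * x (Sum.inr (Sum.inr (Sum.inr (Sum.inl (a, j))))) +
      wt K a j * x (Sum.inr (Sum.inr (Sum.inr (Sum.inr (a, i))))) := by
    intro p x i j a
    have e : ∀ b : Fin r, ∀ f : Fin 3 → K, (∑ l, if a = b then f l else 0) =
        if a = b then ∑ l, f l else 0 := by
      intro b f; split_ifs <;> simp
    simp only [J, Fintype.sum_sum_type, Sum.elim_inl, Sum.elim_inr, c, Fintype.sum_prod_type,
      apply_ite (eval p), map_zero, mul_ite, mul_zero, Finset.sum_ite_eq,
      Finset.mem_univ, if_true, Finset.sum_add_distrib, U, V, Z, map_mul, eval_X, eval_C, e]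
    simp only [mul_comm (x _)]
    ring
  obtain ⟨u, v, ζ, hP⟩ := exists_pairCond (K := K) r hr
  refine (eventually_system c
    (fun q => Sum.elim (u q.2.2.1) (Sum.elim (v q.2.2.1) (ζ q.2.2.1)) q.2.2.2) ?_).mono ?_
  · intro x hx
    have := hP (fun i a => x (Sum.inl (i, a))) (fun i a => x (Sum.inr (Sum.inl (i, a))))
      (fun i a => x (Sum.inr (Sum.inr (Sum.inl (i, a)))))
      (fun i a => x (Sum.inr (Sum.inr (Sum.inr (Sum.inl (i, a))))))
      (fun i a => x (Sum.inr (Sum.inr (Sum.inr (Sum.inr (i, a))))))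
      (fun i i' j hi => (hc1 _ x i i' j hi).symm.trans (hx _))
      (fun i i' j hi => (hc2 _ x i i' j hi).symm.trans (hx _))
      (fun i j a => (hc3 _ x i j a).symm.trans (hx _))
    rintro (⟨i, a⟩ | ⟨i, a⟩ | ⟨i, a⟩ | ⟨i, a⟩ | ⟨i, a⟩)
    exacts [(this.1 i a).1, (this.1 i a).2, this.2.1 i a, (this.2.2 i a).1, (this.2.2 i a).2]
  · intro p hp x y z s t h1 h2 h3
    have := hp (Sum.elim (fun l => x l.1 l.2) (Sum.elim (fun l => y l.1 l.2)
      (Sum.elim (fun l => z l.1 l.2) (Sum.elim (fun l => s l.1 l.2) fun l => t l.1 l.2)))) (by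
        rintro (⟨⟨⟨i, i'⟩, hi⟩, j⟩ | ⟨⟨⟨i, i'⟩, hi⟩, j⟩ | ⟨i, j, a⟩)
        · rw [hc1]; exact h1 i i' j hi
        · rw [hc2]; exact h2 i i' j hi
        · rw [hc3]; exact h3 i j a)
    exact ⟨fun i a => ⟨this (Sum.inl (i, a)), this (Sum.inr (Sum.inl (i, a)))⟩,
      fun i a => this (Sum.inr (Sum.inr (Sum.inl (i, a)))),
      fun i a => ⟨this (Sum.inr (Sum.inr (Sum.inr (Sum.inl (i, a))))),
        this (Sum.inr (Sum.inr (Sum.inr (Sum.inr (i, a)))))⟩⟩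
end

section
variable {K : Type*} [Field K]

/-- The derivative at `p` in the direction `ℓ` of the monomial `x_a x_b x_c`. -/
def cub {σ : Type*} (p ℓ : σ → K) (a b c : σ) : K :=
  ℓ a * (p b * p c) + ℓ b * (p a * p c) + ℓ c * (p a * p b)

theorem exists_mon_cub {σ : Type*} [Fintype σ] (a b c : σ) :
    ∃ μ : Mon σ 3, ∀ p ℓ : σ → K, dv 3 p ℓ μ = cub p ℓ a b c := by
  classical
  refine ⟨⟨Pi.single a 1 + Pi.single b 1 + Pi.single c 1, by
    simp [Finset.sum_add_distrib]⟩, fun p ℓ => ?_⟩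
  have h1 : ∀ v : σ, mon K (Pi.single v 1 : σ → ℕ) = X v := by
    intro v
    rw [mon, Finset.prod_eq_single v]
    · simp
    · intro i _ hi; simp [hi]
    · simp
  have h2 : mon K (Pi.single a 1 + Pi.single b 1 + Pi.single c 1 : σ → ℕ) = X a * X b * X c := by
    rw [← h1 a, ← h1 b, ← h1 c]
    simp only [mon, Pi.add_apply, pow_add, Finset.prod_mul_distrib]
  rw [dv_apply_apply]
  simp only [h2, Derivation.leibniz, pderiv_X, map_add, smul_eq_mul, map_mul, eval_X, mul_add,
    Finset.sum_add_distrib, cub]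
  have h3 : ∀ (x : σ) (t : K), ∑ v, ℓ v * (t * eval p ((Pi.single v 1 : σ → MvPolynomial σ K) x)) =
      ℓ x * t := by
    intro x t
    rw [Finset.sum_eq_single x]
    · simp
    · intro i _ hi; simp [hi.symm]
    · simp
  have h3' := h3 c (p a * p b)
  have h4 := h3 b (p c * p a)
  have h5 := h3 a (p c * p b)
  simp only [mul_assoc] at h3' h4 h5 ⊢
  rw [h3', h4, h5]
  ring

variable {G r : ℕ}

/-- Variables: `G` groups of three variables, and `r` further variables. -/
abbrev Vars (G r : ℕ) := (Fin G × Fin 3) ⊕ Fin r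

/-- Pairs of groups. -/
abbrev Prs (G : ℕ) := {q : Fin G × Fin G // q.1 < q.2}

/-- A coordinate point. -/
def ptA (K : Type*) [Field K] (r : ℕ) (x : Fin G × Fin 3) : Vars G r → K :=
  Sum.elim (fun k => if k = x then 1 else 0) 0

/-- A point attached to a group of variables and a further variable. -/
def ptB (K : Type*) [Field K] (x : Fin G × Fin r) : Vars G r → K :=
  Sum.elim (fun k => if k.1 = x.1 then wt K x.2 k.2 else 0) (fun b => if b = x.2 then 1 else 0)

/-- A point attached to a pair of groups of variables. -/
def ptC (p : Par G r → K) (x : Prs G × Fin 3) : Vars G r → K :=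
  Sum.elim (fun k => if k.1 = x.1.1.1 then p (x.1.1.1, x.1.1.2, x.2, Sum.inl k.2) else
      if k.1 = x.1.1.2 then p (x.1.1.1, x.1.1.2, x.2, Sum.inr (Sum.inl k.2)) else 0)
    (fun b => p (x.1.1.1, x.1.1.2, x.2, Sum.inr (Sum.inr b)))

/-- The extra coordinate point. -/
def ptD (K : Type*) [Field K] (G r : ℕ) : Vars G r → K :=
  Sum.elim 0 (fun b => if (b : ℕ) = 0 then 1 else 0)

theorem ptA_mul {x : Fin G × Fin 3} {v w : Vars G r} (h : v ≠ w) :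
    ptA K r x v * ptA K r x w = 0 := by
  rcases v with v | v <;> rcases w with w | w <;> simp [ptA]
  rintro rfl rfl
  exact h rfl

theorem cub_ptA {x : Fin G × Fin 3} (ℓ : Vars G r → K) {a b c : Vars G r} (h1 : a ≠ b)
    (h2 : a ≠ c) (h3 : b ≠ c) : cub (ptA K r x) ℓ a b c = 0 := by
  rw [cub, ptA_mul h1, ptA_mul h2, ptA_mul h3]
  ring

theorem ptB_mul {x : Fin G × Fin r} {v w : Fin G × Fin 3} (h : v.1 ≠ w.1) :
    ptB K x (Sum.inl v) * ptB K x (Sum.inl w) = 0 := by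
  simp only [ptB, Sum.elim_inl]
  split_ifs with h1 h2
  · exact absurd (h1.trans h2.symm) h
  all_goals simp

theorem ptC_of_ne (p : Par G r → K) {x : Prs G × Fin 3} {v : Fin G × Fin 3}
    (h1 : v.1 ≠ x.1.1.1) (h2 : v.1 ≠ x.1.1.2) : ptC p x (Sum.inl v) = 0 := by
  simp [ptC, h1, h2]

theorem eq_of_mem_pair {g h : Fin G} (hgh : g < h) (q : Prs G) (h1 : g = q.1.1 ∨ g = q.1.2)
    (h2 : h = q.1.1 ∨ h = q.1.2) : q = ⟨(g, h), hgh⟩ := by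
  obtain ⟨⟨a, b⟩, hab⟩ := q
  simp only at hab h1 h2
  simp only [Subtype.mk.injEq, Prod.mk.injEq]
  omega

theorem ptC_mul (p : Par G r → K) {g h : Fin G} (hgh : g < h) {x : Prs G × Fin 3}
    (hx : x.1 ≠ ⟨(g, h), hgh⟩) (i j : Fin 3) :
    ptC p x (Sum.inl (g, i)) * ptC p x (Sum.inl (h, j)) = 0 := by
  by_contra hne
  apply hx
  refine eq_of_mem_pair hgh x.1 ?_ ?_ <;> by_contra! hc
  · exact left_ne_zero_of_mul hne (ptC_of_ne p hc.1 hc.2)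
  · exact right_ne_zero_of_mul hne (ptC_of_ne p hc.1 hc.2)

theorem sum_prs (q : Prs G) (F : Prs G × Fin 3 → K) (hF : ∀ x, x.1 ≠ q → F x = 0) :
    ∑ x, F x = ∑ i, F (q, i) := by
  rw [Fintype.sum_prod_type, Finset.sum_eq_single q]
  · intro b _ hb
    exact Finset.sum_eq_zero fun i _ => hF (b, i) hb
  · simp

theorem sum_group (g : Fin G) (F : Fin G × Fin r → K) (hF : ∀ x, x.1 ≠ g → F x = 0) :
    ∑ x, F x = ∑ i, F (g, i) := by
  rw [Fintype.sum_prod_type, Finset.sum_eq_single g]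
  · intro b _ hb
    exact Finset.sum_eq_zero fun i _ => hF (b, i) hb
  · simp

variable {p : Par G r → K} {ℓA : Fin G × Fin 3 → Vars G r → K} {ℓB : Fin G × Fin r → Vars G r → K}
  {ℓC : Prs G × Fin 3 → Vars G r → K} {ℓD : Fin (r - 1) → Vars G r → K}

/-- A linear relation between tangent vectors at the chosen points. -/
def TgRel (p : Par G r → K) (ℓA : Fin G × Fin 3 → Vars G r → K) (ℓB : Fin G × Fin r → Vars G r → K)
    (ℓC : Prs G × Fin 3 → Vars G r → K) (ℓD : Fin (r - 1) → Vars G r → K) : Prop :=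
  ∀ a b c, ∑ x, cub (ptA K r x) (ℓA x) a b c + ∑ x, cub (ptB K x) (ℓB x) a b c +
    ∑ x, cub (ptC p x) (ℓC x) a b c + ∑ x, cub (ptD K G r) (ℓD x) a b c = 0

theorem TgRel.sumC {a b c : Vars G r} (H : TgRel p ℓA ℓB ℓC ℓD) (h1 : a ≠ b) (h2 : a ≠ c) (h3 : b ≠ c) :
    ∑ x, cub (ptB K x) (ℓB x) a b c + ∑ x, cub (ptC p x) (ℓC x) a b c +
      ∑ x, cub (ptD K G r) (ℓD x) a b c = 0 := by
  have := H a b c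
  rwa [Finset.sum_eq_zero fun x _ => cub_ptA (ℓA x) h1 h2 h3, zero_add] at this

theorem cub_ptD (ℓ : Vars G r → K) (v w : Fin G × Fin 3) (c : Vars G r) :
    cub (ptD K G r) ℓ (Sum.inl v) (Sum.inl w) c = 0 := by
  simp [cub, ptD]

theorem TgRel.triple (H : TgRel p ℓA ℓB ℓC ℓD) {g h k : Fin G} (hgh : g < h) (hhk : h < k)
    (hT : TripleCond
      (fun i a => p (g, h, i, Sum.inl a)) (fun i a => p (g, h, i, Sum.inr (Sum.inl a)))
      (fun i a => p (g, k, i, Sum.inl a)) (fun i a => p (g, k, i, Sum.inr (Sum.inl a)))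
      (fun i a => p (h, k, i, Sum.inl a)) (fun i a => p (h, k, i, Sum.inr (Sum.inl a)))) (i a : Fin 3) :
    ℓC (⟨(g, h), hgh⟩, i) (Sum.inl (k, a)) = 0 ∧
    ℓC (⟨(g, k), hgh.trans hhk⟩, i) (Sum.inl (h, a)) = 0 ∧
    ℓC (⟨(h, k), hhk⟩, i) (Sum.inl (g, a)) = 0 := by
  refine hT (fun i a => ℓC (⟨(g, h), hgh⟩, i) (Sum.inl (k, a)))
    (fun i a => ℓC (⟨(g, k), hgh.trans hhk⟩, i) (Sum.inl (h, a)))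
    (fun i a => ℓC (⟨(h, k), hhk⟩, i) (Sum.inl (g, a))) ?_ i a
  intro a b c
  have hgk := hgh.trans hhk
  have := H.sumC (a := Sum.inl (g, a)) (b := Sum.inl (h, b)) (c := Sum.inl (k, c))
    (by simp [hgh.ne]) (by simp [hgk.ne]) (by simp [hhk.ne])
  rw [Finset.sum_eq_zero (fun x _ => by
      rw [cub, ptB_mul (v := (h, b)) (w := (k, c)) hhk.ne, ptB_mul (v := (g, a)) (w := (k, c)) hgk.ne,
        ptB_mul (v := (g, a)) (w := (h, b)) hgh.ne]; ring), zero_add,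
    Finset.sum_eq_zero (fun x _ => cub_ptD _ _ _ _), add_zero] at this
  simp only [cub, Finset.sum_add_distrib] at this
  rw [sum_prs ⟨(h, k), hhk⟩ _ (fun x hx => by rw [ptC_mul p hhk hx, mul_zero]),
    sum_prs ⟨(g, k), hgk⟩ _ (fun x hx => by rw [ptC_mul p hgk hx, mul_zero]),
    sum_prs ⟨(g, h), hgh⟩ _ (fun x hx => by rw [ptC_mul p hgh hx, mul_zero])] at this
  simp only [ptC, Sum.elim_inl, if_true, if_neg hgh.ne', if_neg hgk.ne', if_neg hhk.ne'] at this
  rw [← this]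
  simp only [Finset.sum_add_distrib]
  simp only [mul_comm (ℓC _ _)]
  ring

/-- The parameters of the construction are in general position. -/
def Gen (p : Par G r → K) : Prop :=
  (∀ g h k : Fin G, g < h → h < k → TripleCond
      (fun i a => p (g, h, i, Sum.inl a)) (fun i a => p (g, h, i, Sum.inr (Sum.inl a)))
      (fun i a => p (g, k, i, Sum.inl a)) (fun i a => p (g, k, i, Sum.inr (Sum.inl a)))
      (fun i a => p (h, k, i, Sum.inl a)) (fun i a => p (h, k, i, Sum.inr (Sum.inl a)))) ∧
  ∀ g h : Fin G, PairCond
      (fun i a => p (g, h, i, Sum.inl a)) (fun i a => p (g, h, i, Sum.inr (Sum.inl a)))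
      (fun i a => p (g, h, i, Sum.inr (Sum.inr a)))

theorem exists_gen [CharZero K] (hr : r < 3) : ∃ p : Par G r → K, Gen p := by
  have h1 : ∀ᶠ p in zar K (Par G r), Gen p := by
    refine Filter.Eventually.and ?_ ?_
    · simp only [Filter.eventually_all]
      exact fun g h k hgh hhk => eventually_tripleCond hgh hhk
    · simp only [Filter.eventually_all]
      exact fun g h => eventually_pairCond hr g h
  exact h1.exists

theorem TgRel.of_ne (H : TgRel p ℓA ℓB ℓC ℓD) (hp : Gen p) (x : Prs G × Fin 3) (v : Fin G × Fin 3)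
    (h1 : v.1 ≠ x.1.1.1) (h2 : v.1 ≠ x.1.1.2) : ℓC x (Sum.inl v) = 0 := by
  obtain ⟨⟨⟨g, h⟩, hgh⟩, i⟩ := x
  obtain ⟨k, a⟩ := v
  simp only at hgh h1 h2
  rcases lt_or_gt_of_ne h1 with h3 | h3
  · exact (H.triple h3 hgh (hp.1 _ _ _ h3 hgh) i a).2.2
  · rcases lt_or_gt_of_ne h2 with h4 | h4
    · exact (H.triple h3 h4 (hp.1 _ _ _ h3 h4) i a).2.1
    · exact (H.triple hgh h4 (hp.1 _ _ _ hgh h4) i a).1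

theorem TgRel.mul_eq_zero (H : TgRel p ℓA ℓB ℓC ℓD) (hp : Gen p) {g h : Fin G} (hgh : g < h)
    {x : Prs G × Fin 3} (hx : x.1 ≠ ⟨(g, h), hgh⟩) (i j : Fin 3) :
    ℓC x (Sum.inl (g, i)) * ptC p x (Sum.inl (h, j)) = 0 ∧
    ℓC x (Sum.inl (h, j)) * ptC p x (Sum.inl (g, i)) = 0 := by
  constructor <;> by_contra hne <;> refine hx (eq_of_mem_pair hgh x.1 ?_ ?_) <;> by_contra! hc
  · exact left_ne_zero_of_mul hne (H.of_ne hp _ _ hc.1 hc.2)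
  · exact right_ne_zero_of_mul hne (ptC_of_ne p hc.1 hc.2)
  · exact right_ne_zero_of_mul hne (ptC_of_ne p hc.1 hc.2)
  · exact left_ne_zero_of_mul hne (H.of_ne hp _ _ hc.1 hc.2)
end

section
variable {K : Type*} [Field K] {G r : ℕ}
variable {p : Par G r → K} {ℓA : Fin G × Fin 3 → Vars G r → K} {ℓB : Fin G × Fin r → Vars G r → K}
  {ℓC : Prs G × Fin 3 → Vars G r → K} {ℓD : Fin (r - 1) → Vars G r → K}

theorem sum_ptB_pair (ℓB : Fin G × Fin r → Vars G r → K) {g h : Fin G} (hgh : g ≠ h)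
    (i i' j : Fin 3) :
    ∑ x, cub (ptB K x) (ℓB x) (Sum.inl (g, i)) (Sum.inl (g, i')) (Sum.inl (h, j)) =
      ∑ a : Fin r, wt K a i * wt K a i' * ℓB (g, a) (Sum.inl (h, j)) := by
  rw [sum_group g]
  · refine Finset.sum_congr rfl fun a _ => ?_
    simp [cub, ptB, hgh.symm]
    ring
  · intro x hx
    simp [cub, ptB, hx.symm]

theorem sum_ptB_mixed (ℓB : Fin G × Fin r → Vars G r → K) {g h : Fin G} (hgh : g ≠ h)
    (i j : Fin 3) (a : Fin r) :
    ∑ x, cub (ptB K x) (ℓB x) (Sum.inl (g, i)) (Sum.inl (h, j)) (Sum.inr a) =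
      wt K a i * ℓB (g, a) (Sum.inl (h, j)) + wt K a j * ℓB (h, a) (Sum.inl (g, i)) := by
  have h1 : ∀ x : Fin G × Fin r, cub (ptB K x) (ℓB x) (Sum.inl (g, i)) (Sum.inl (h, j))
      (Sum.inr a) = (if x = (g, a) then wt K a i * ℓB (g, a) (Sum.inl (h, j)) else 0) +
        if x = (h, a) then wt K a j * ℓB (h, a) (Sum.inl (g, i)) else 0 := by
    rintro ⟨k, b⟩
    simp only [cub, ptB, Sum.elim_inl, Sum.elim_inr, Prod.mk.injEq]
    by_cases hab : a = b
    · subst hab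
      by_cases hg : k = g
      · subst hg
        simp [hgh, hgh.symm]
        ring
      · by_cases hh : k = h
        · subst hh
          simp [hgh, hg]
          ring
        · simp [hg, hh, Ne.symm hg, Ne.symm hh]
    · simp only [hab, Ne.symm hab, and_false, if_false]
      split_ifs with h1 h2
      · exact absurd (h1.trans h2.symm) hgh.symm
      all_goals ring
  simp only [h1, Finset.sum_add_distrib, Finset.sum_ite_eq', Finset.mem_univ, if_true]

theorem TgRel.pair (H : TgRel p ℓA ℓB ℓC ℓD) (hp : Gen p) {g h : Fin G} (hgh : g < h) :
    (∀ c i, ℓC (⟨(g, h), hgh⟩, c) (Sum.inl (g, i)) = 0 ∧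
      ℓC (⟨(g, h), hgh⟩, c) (Sum.inl (h, i)) = 0) ∧
    (∀ c a, ℓC (⟨(g, h), hgh⟩, c) (Sum.inr a) = 0) ∧
    ∀ a i, ℓB (g, a) (Sum.inl (h, i)) = 0 ∧ ℓB (h, a) (Sum.inl (g, i)) = 0 := by
  refine hp.2 g h (fun c i => ℓC (⟨(g, h), hgh⟩, c) (Sum.inl (g, i)))
    (fun c i => ℓC (⟨(g, h), hgh⟩, c) (Sum.inl (h, i)))
    (fun c a => ℓC (⟨(g, h), hgh⟩, c) (Sum.inr a))
    (fun a i => ℓB (g, a) (Sum.inl (h, i))) (fun a i => ℓB (h, a) (Sum.inl (g, i))) ?_ ?_ ?_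
  · intro i i' j hi
    have := H.sumC (a := Sum.inl (g, i)) (b := Sum.inl (g, i')) (c := Sum.inl (h, j))
      (by simp [hi.ne]) (by simp [hgh.ne]) (by simp [hgh.ne])
    rw [Finset.sum_eq_zero (fun x _ => cub_ptD (ℓD x) (g, i) (g, i') _), add_zero,
      sum_ptB_pair ℓB hgh.ne, sum_prs ⟨(g, h), hgh⟩ _ (fun x hx => by
        rw [cub, ptC_mul p hgh hx, ptC_mul p hgh hx, ← mul_assoc (ℓC x (Sum.inl (h, j))),
          (H.mul_eq_zero hp hgh hx i j).2]; ring), add_comm] at this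
    rw [← this]
    simp only [cub, ptC, Sum.elim_inl, if_true, if_neg hgh.ne']
    congr 1
    refine Finset.sum_congr rfl fun c _ => ?_
    ring
  · intro i i' j hi
    have := H.sumC (a := Sum.inl (h, i)) (b := Sum.inl (h, i')) (c := Sum.inl (g, j))
      (by simp [hi.ne]) (by simp [hgh.ne']) (by simp [hgh.ne'])
    rw [Finset.sum_eq_zero (fun x _ => cub_ptD (ℓD x) (h, i) (h, i') _), add_zero,
      sum_ptB_pair ℓB hgh.ne', sum_prs ⟨(g, h), hgh⟩ _ (fun x hx => by
        rw [cub, mul_comm (ptC p x (Sum.inl (h, i'))) (ptC p x (Sum.inl (g, j))),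
          mul_comm (ptC p x (Sum.inl (h, i))) (ptC p x (Sum.inl (g, j))),
          ptC_mul p hgh hx, ptC_mul p hgh hx, ← mul_assoc (ℓC x (Sum.inl (g, j))),
          (H.mul_eq_zero hp hgh hx j i).1]; ring), add_comm] at this
    rw [← this]
    simp only [cub, ptC, Sum.elim_inl, if_true, if_neg hgh.ne']
    congr 1
    refine Finset.sum_congr rfl fun c _ => ?_
    ring
  · intro i j a
    have := H.sumC (a := Sum.inl (g, i)) (b := Sum.inl (h, j)) (c := Sum.inr a)
      (by simp [hgh.ne]) (by simp) (by simp)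
    rw [Finset.sum_eq_zero (fun x _ => cub_ptD (ℓD x) (g, i) (h, j) _), add_zero,
      sum_ptB_mixed ℓB hgh.ne, sum_prs ⟨(g, h), hgh⟩ _ (fun x hx => by
        rw [cub, ptC_mul p hgh hx, ← mul_assoc (ℓC x (Sum.inl (g, i))),
          ← mul_assoc (ℓC x (Sum.inl (h, j))), (H.mul_eq_zero hp hgh hx i j).1,
          (H.mul_eq_zero hp hgh hx i j).2]; ring), add_comm] at this
    rw [← this]
    simp only [cub, ptC, Sum.elim_inl, Sum.elim_inr, if_true, if_neg hgh.ne', ← add_assoc]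
    congr 2
    refine Finset.sum_congr rfl fun c _ => ?_
    ring

theorem TgRel.zeroC (H : TgRel p ℓA ℓB ℓC ℓD) (hp : Gen p) (x : Prs G × Fin 3) : ℓC x = 0 := by
  ext1 v
  obtain ⟨⟨⟨g, h⟩, hgh⟩, i⟩ := x
  obtain ⟨h1, h2, h3⟩ := H.pair hp hgh
  rcases v with ⟨k, a⟩ | a
  · by_cases hg : k = g
    · subst hg; exact (h1 i a).1
    · by_cases hh : k = h
      · subst hh; exact (h1 i a).2
      · exact H.of_ne hp _ _ hg hh
  · exact h2 i a

theorem TgRel.zeroB_of_ne (H : TgRel p ℓA ℓB ℓC ℓD) (hp : Gen p) {g h : Fin G} (hgh : g ≠ h)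
    (a : Fin r) (i : Fin 3) : ℓB (g, a) (Sum.inl (h, i)) = 0 := by
  rcases lt_or_gt_of_ne hgh with h1 | h1
  · exact ((H.pair hp h1).2.2 a i).1
  · exact ((H.pair hp h1).2.2 a i).2

end

section
variable {K : Type*} [Field K] {G r : ℕ}
variable {p : Par G r → K} {ℓA : Fin G × Fin 3 → Vars G r → K} {ℓB : Fin G × Fin r → Vars G r → K}
  {ℓC : Prs G × Fin 3 → Vars G r → K} {ℓD : Fin (r - 1) → Vars G r → K}

theorem eq_zero_of_group_system [CharZero K] (hr : r < 3) (L : Fin r → Fin 3 → K)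
    (M : Fin r → Fin r → K)
    (hZ : ∀ i (a b : Fin r), (r = 2 → ¬ ((a : ℕ) = 0 ∧ (b : ℕ) = 0)) →
      ∑ c, (L c i * ((if a = c then 1 else 0) * if b = c then 1 else 0) +
        M c a * (wt K c i * if b = c then 1 else 0) +
        M c b * (wt K c i * if a = c then 1 else 0)) = 0)
    (hY : ∀ i j b, i < j → ∑ c, (L c i * (wt K c j * if b = c then 1 else 0) +
      L c j * (wt K c i * if b = c then 1 else 0) + M c b * (wt K c i * wt K c j)) = 0)
    (hX : ∑ c, (L c 0 * (wt K c 1 * wt K c 2) + L c 1 * (wt K c 0 * wt K c 2) +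
      L c 2 * (wt K c 0 * wt K c 1)) = 0) :
    (∀ c i, L c i = 0) ∧ ∀ c b, M c b = 0 := by
  interval_cases r
  · simp
  · simp [Fin.forall_fin_succ, wt] at hZ hY hX ⊢
    grind
  · simp [Fin.forall_fin_succ, Fin.sum_univ_succ, wt] at hZ hY hX ⊢
    grind

theorem TgRel.group [CharZero K] (hr : r < 3) (H : TgRel p ℓA ℓB ℓC ℓD) (hp : Gen p) (g : Fin G) :
    (∀ c i, ℓB (g, c) (Sum.inl (g, i)) = 0) ∧ ∀ c b, ℓB (g, c) (Sum.inr b) = 0 := by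
  have hC : ∀ a b c, ∑ x, cub (ptC p x) (ℓC x) a b c = 0 := fun a b c =>
    Finset.sum_eq_zero fun x _ => by simp [H.zeroC hp x, cub]
  refine eq_zero_of_group_system hr (fun c i => ℓB (g, c) (Sum.inl (g, i)))
    (fun c b => ℓB (g, c) (Sum.inr b)) ?_ ?_ ?_
  · intro i a b hab
    have := H (Sum.inl (g, i)) (Sum.inr a) (Sum.inr b)
    rw [hC, Finset.sum_eq_zero (fun x _ => by simp [cub, ptA]), zero_add, add_zero,
      Finset.sum_eq_zero (f := fun x => cub (ptD K G r) (ℓD x) _ _ _), add_zero,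
      sum_group g] at this
    · simpa [cub, ptB] using this
    · rintro ⟨k, c⟩ hx
      simp only at hx
      simp [cub, ptB, Ne.symm hx, H.zeroB_of_ne hp hx]
    · intro x _
      have := hab (by have := x.2; omega)
      simp [cub, ptD]
      tauto
  · intro i j b hij
    have := H.sumC (a := Sum.inl (g, i)) (b := Sum.inl (g, j)) (c := Sum.inr b)
      (by simp [hij.ne]) (by simp) (by simp)
    rw [hC, Finset.sum_eq_zero (fun x _ => cub_ptD (ℓD x) (g, i) (g, j) _), add_zero, add_zero,
      sum_group g] at this
    · simpa [cub, ptB] using this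
    · rintro ⟨k, c⟩ hx
      simp only at hx
      simp [cub, ptB, Ne.symm hx]
  · have := H.sumC (a := Sum.inl (g, 0)) (b := Sum.inl (g, 1)) (c := Sum.inl (g, 2))
      (by simp) (by simp) (by simp)
    rw [hC, Finset.sum_eq_zero (fun x _ => cub_ptD (ℓD x) (g, 0) (g, 1) _), add_zero, add_zero,
      sum_group g] at this
    · simpa [cub, ptB] using this
    · rintro ⟨k, c⟩ hx
      simp only at hx
      simp [cub, ptB, Ne.symm hx]

theorem TgRel.zeroB [CharZero K] (hr : r < 3) (H : TgRel p ℓA ℓB ℓC ℓD) (hp : Gen p)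
    (x : Fin G × Fin r) : ℓB x = 0 := by
  ext1 v
  obtain ⟨g, a⟩ := x
  rcases v with ⟨k, i⟩ | b
  · by_cases hk : g = k
    · subst hk; exact (H.group hr hp g).1 a i
    · exact H.zeroB_of_ne hp hk a i
  · exact (H.group hr hp g).2 a b

theorem TgRel.zeroD [CharZero K] (hr : r < 3) (H : TgRel p ℓA ℓB ℓC ℓD) (hp : Gen p)
    (x : Fin (r - 1)) : ℓD x = 0 := by
  have hr2 : r = 2 := by have := x.2; omega
  subst hr2
  have h1 : ∀ v, cub (ptD K G 2) (ℓD 0) v (Sum.inr 0) (Sum.inr 0) = 0 := by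
    intro v
    have := H v (Sum.inr 0) (Sum.inr 0)
    rw [Finset.sum_eq_zero (fun x _ => by simp [cub, ptA]),
      Finset.sum_eq_zero (fun x _ => by simp [cub, H.zeroB hr hp x]),
      Finset.sum_eq_zero (fun x _ => by simp [cub, H.zeroC hp x])] at this
    simpa using this
  have h2 : ℓD 0 (Sum.inr 0) = 0 := by
    have := h1 (Sum.inr 0)
    simp [cub, ptD] at this
    have h3 : (3 : K) * ℓD 0 (Sum.inr 0) = 0 := by linear_combination this
    simpa using h3
  rw [Subsingleton.elim (α := Fin 1) x 0]
  ext1 v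
  have := h1 v
  simpa [cub, ptD, h2] using this

theorem TgRel.zeroA [CharZero K] (hr : r < 3) (H : TgRel p ℓA ℓB ℓC ℓD) (hp : Gen p)
    (x : Fin G × Fin 3) : ℓA x = 0 := by
  have h1 : ∀ v, cub (ptA K r x) (ℓA x) v (Sum.inl x) (Sum.inl x) = 0 := by
    intro v
    have := H v (Sum.inl x) (Sum.inl x)
    rw [Finset.sum_eq_zero (f := fun y => cub (ptB K y) _ _ _ _)
        (fun y _ => by simp [cub, H.zeroB hr hp y]),
      Finset.sum_eq_zero (f := fun y => cub (ptC p y) _ _ _ _)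
        (fun y _ => by simp [cub, H.zeroC hp y]),
      Finset.sum_eq_zero (f := fun y => cub (ptD K G r) _ _ _ _)
        (fun y _ => by simp [cub, H.zeroD hr hp y]),
      Finset.sum_eq_single x] at this
    · simpa using this
    · intro y _ hy
      simp [cub, ptA, hy.symm]
    · simp
  have h2 : ℓA x (Sum.inl x) = 0 := by
    have := h1 (Sum.inl x)
    simp [cub, ptA] at this
    have h3 : (3 : K) * ℓA x (Sum.inl x) = 0 := by linear_combination this
    simpa using h3
  ext1 v
  have := h1 v
  simpa [cub, ptA, h2] using this

theorem exists_indepD_three [CharZero K] (G : ℕ) (hr : r < 3) :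
    ∃ p : (Fin G × Fin 3) ⊕ (Fin G × Fin r) ⊕ (Prs G × Fin 3) ⊕ Fin (r - 1) → Vars G r → K,
      IndepD K 3 p := by
  obtain ⟨p, hp⟩ := exists_gen (K := K) (G := G) hr
  refine ⟨Sum.elim (ptA K r) (Sum.elim (ptB K) (Sum.elim (ptC p) fun _ => ptD K G r)), ?_⟩
  rw [indepD_iff]
  intro ℓ hℓ
  have H : TgRel p (fun x => ℓ (Sum.inl x)) (fun x => ℓ (Sum.inr (Sum.inl x)))
      (fun x => ℓ (Sum.inr (Sum.inr (Sum.inl x)))) (fun x => ℓ (Sum.inr (Sum.inr (Sum.inr x)))) := by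
    intro a b c
    obtain ⟨μ, hμ⟩ := exists_mon_cub (K := K) a b c
    have := congrFun hℓ μ
    simpa only [Finset.sum_apply, hμ, Fintype.sum_sum_type, Sum.elim_inl, Sum.elim_inr,
      Pi.zero_apply, add_assoc] using this
  rintro (x | x | x | x)
  exacts [H.zeroA hr hp x, H.zeroB hr hp x, H.zeroC hp x, H.zeroD hr hp x]

theorem card_prs (G : ℕ) : 2 * Fintype.card (Prs G) + G = G * G := by
  have h1 : Fintype.card (Prs G) = ∑ i ∈ Finset.range G, i := by
    rw [Fintype.card_subtype, Finset.card_filter, Fintype.sum_prod_type_right,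
      ← Fin.sum_univ_eq_sum_range fun i => i]
    refine Finset.sum_congr rfl fun h _ => ?_
    rw [← Finset.card_filter, ← Fin.card_Iio h]
    congr 1
    ext x
    simp
  rw [h1, mul_comm, Finset.sum_range_id_mul_two]
  rcases G with _ | G
  · rfl
  · simp; ring

/-- The expected maximal number of independent double points. -/
def maxGood (m d : ℕ) : ℕ := ((m + d).choose d + m + 1) / (m + 2)

theorem Good.congr {σ τ : Type*} [Fintype σ] [Fintype τ] (e : σ ≃ τ) {d q : ℕ}
    (h : Good K σ d q) : Good K τ d q := by
  obtain ⟨p, hp⟩ := h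
  refine ⟨fun j v => p j (e.symm v), ?_⟩
  rw [indepD_iff] at hp ⊢
  intro ℓ hℓ j
  have key : ∀ j, ℓ j ∘ e = 0 := by
    refine hp (fun j => ℓ j ∘ e) ?_
    ext μ
    have := congrFun hℓ ⟨fun v => μ.1 (e.symm v), by rw [Equiv.sum_comp]; exact μ.2⟩
    simp only [Finset.sum_apply, dv_apply_apply, Pi.zero_apply] at this ⊢
    rw [← this]
    refine Finset.sum_congr rfl fun j _ => ?_
    rw [← Equiv.sum_comp e]
    refine Finset.sum_congr rfl fun v _ => ?_
    have h1 : mon K (fun v => μ.1 (e.symm v)) = rename e (mon K μ.1) := by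
      simp only [mon, map_prod, map_pow, rename_X]
      rw [← Equiv.prod_comp e]
      simp
    rw [h1, pderiv_rename e.injective, eval_rename]
    simp [Function.comp_def]
  ext1 v
  simpa using congrFun (key j) (e.symm v)

theorem choose_three_mul (m : ℕ) : 6 * (m + 3).choose 3 = (m + 1) * (m + 2) * (m + 3) := by
  have := Nat.ascFactorial_eq_factorial_mul_choose m 3
  simp [Nat.ascFactorial, Nat.factorial] at this
  linarith

theorem good_three [CharZero K] {m : ℕ} (hm : 2 ≤ m) : Good K (Fin (m + 1)) 3 (maxGood m 3) := by
  obtain ⟨G, r, hr, hG, h1⟩ : ∃ G r, r < 3 ∧ 1 ≤ G ∧ m + 1 = 3 * G + r :=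
    ⟨(m + 1) / 3, (m + 1) % 3, by omega, by omega, by omega⟩
  obtain ⟨p, hp⟩ := exists_indepD_three (K := K) G hr
  have hcard : Fintype.card (Vars G r) = m + 1 := by simp; omega
  refine (good_of_indepD hp (maxGood m 3) ?_).congr (Fintype.equivFinOfCardEq hcard)
  have h2 := card_prs G
  have h3 := choose_three_mul m
  simp only [Fintype.card_sum, Fintype.card_prod, Fintype.card_fin]
  generalize Fintype.card (Prs G) = P at h2
  rw [maxGood, ← Nat.lt_add_one_iff, Nat.div_lt_iff_lt_mul (by omega)]
  generalize (m + 3).choose 3 = c at h3 ⊢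
  have h4 : (m + 1) * (m + 3) ≤ 6 * (G * 3 + (G * r + (P * 3 + (r - 1)))) := by
    rw [h1, show m + 3 = 3 * G + r + 2 by omega]
    interval_cases r <;> norm_num <;> nlinarith
  nlinarith
end

section
variable {K : Type*} [Field K] {σ : Type*} [Fintype σ] {d : ℕ}

theorem Good.rankGE {e : ℕ} (h : Good K σ d e) : RankGE K σ d e (e * Fintype.card σ) := by
  obtain ⟨p, hp⟩ := h
  exact ⟨p, by rw [hp.finrank_dspan, Fintype.card_fin]⟩

theorem finrank_dspan_comp {β γ : Type*} (e : β ≃ γ) (p : γ → σ → K) :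
    Module.finrank K (dspan d (p ∘ e)) = Module.finrank K (dspan d p) := by
  have h : dspan d (p ∘ e) = dspan d p := congrArg _ <| (e.prodCongr (Equiv.refl σ)).surjective.range_comp (fun x : γ × σ => tg d (p x.1) x.2)
  rw [h]

theorem Good.rankGE_add [CharZero K] (hd : d ≠ 0) {q e : ℕ} (h : Good K σ d q) (hq : q ≤ e) :
    RankGE K σ d e (min ((Fintype.card σ + d - 1).choose d) (q * Fintype.card σ + (e - q))) := by
  obtain ⟨k, rfl⟩ := Nat.exists_eq_add_of_le hq
  obtain ⟨p, hp⟩ := h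
  obtain ⟨f, hf⟩ := exists_min_le_finrank_sup (dspan d p) (ev (K := K) (σ := σ) d) k
  rw [span_range_ev, sup_top_eq, finrank_top, finrank_mon, hp.finrank_dspan, Fintype.card_fin] at hf
  refine ⟨Sum.elim p f ∘ finSumFinEquiv.symm, ?_⟩
  rw [finrank_dspan_comp, Nat.add_sub_cancel_left]
  refine hf.trans (Submodule.finrank_mono (sup_le ?_ ?_))
  · exact dspan_le fun j ℓ => dv_mem_dspan (Sum.elim p f) (Sum.inl j) ℓ
  · rw [Submodule.span_le]
    rintro _ ⟨j, rfl⟩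
    exact ev_mem_dspan hd (Sum.elim p f) (Sum.inr j)

theorem good_zero : Good K σ d 0 :=
  ⟨Fin.elim0, by rw [indepD_iff]; exact fun _ _ j => j.elim0⟩

theorem mon_add (μ ν : σ → ℕ) : mon K (μ + ν) = mon K μ * mon K ν := by
  simp only [mon, Pi.add_apply, pow_add, Finset.prod_mul_distrib]

theorem mon_single [DecidableEq σ] (v : σ) (k : ℕ) : mon K (Pi.single v k) = X v ^ k := by
  rw [mon, Finset.prod_eq_single v]
  · simp
  · intro i _ hi; simp [hi]
  · simp

theorem good_one [CharZero K] [Nonempty σ] (hd : d ≠ 0) : Good K σ d 1 := by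
  classical
  obtain ⟨d, rfl⟩ := Nat.exists_eq_succ_of_ne_zero hd
  let o : σ := Classical.arbitrary σ
  refine ⟨fun _ => Pi.single o 1, ?_⟩
  rw [indepD_iff]
  intro ℓ hℓ
  have key : ∀ v, ℓ 0 v + (Pi.single o 1 : σ → K) v * (d * ℓ 0 o) = 0 := by
    intro v
    have := congrFun hℓ ⟨Pi.single o d + Pi.single v 1, by simp [Finset.sum_add_distrib]⟩
    simp only [Finset.univ_unique, Finset.sum_singleton, dv_apply_apply, mon_add, mon_single,
      Derivation.leibniz, Derivation.leibniz_pow, pderiv_X, map_add, smul_eq_mul, map_mul, map_pow,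
      eval_X, mul_add, Finset.sum_add_distrib, Pi.single_eq_same, one_pow, one_mul, pow_one,
      Fin.default_eq_zero, Pi.zero_apply, nsmul_eq_mul, map_natCast] at this
    rw [← this]
    have h3 : ∀ x : σ, ∀ t : K,
        ∑ v, ℓ 0 v * (t * eval (Pi.single o 1) ((Pi.single v 1 : σ → MvPolynomial σ K) x)) =
        ℓ 0 x * t := by
      intro x t
      rw [Finset.sum_eq_single x]
      · simp
      · intro i _ hi; simp [hi.symm]
      · simp
    have h4 := h3 v 1
    have h5 := h3 o ((Pi.single o 1 : σ → K) v * d)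
    simp only [one_mul, mul_assoc] at h4 h5
    rw [h4, h5]
    ring
  have h0 : ℓ 0 o = 0 := by
    have h1 := key o
    have h2 : ((d : K) + 1) * ℓ 0 o = 0 := by
      rw [Pi.single_eq_same] at h1; linear_combination h1
    exact (mul_eq_zero.mp h2).resolve_left (by exact_mod_cast Nat.succ_ne_zero d)
  intro j
  rw [Subsingleton.elim j 0]
  ext1 v
  simpa [h0] using key v

theorem tg_two [DecidableEq σ] (p : σ → K) (v : σ) :
    tg 2 p v = ∑ w, p w • tg 2 (Pi.single w 1 : σ → K) v := by
  ext1 μ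
  have h1 : (mon K μ.1).IsHomogeneous 2 := by
    have := IsHomogeneous.prod Finset.univ (fun i => (X i : MvPolynomial σ K) ^ μ.1 i)
      (fun i => μ.1 i) fun i _ => by simpa using (isHomogeneous_X K i).pow (μ.1 i)
    rwa [μ.2] at this
  have h2 : (pderiv v (mon K μ.1)).IsHomogeneous 1 := h1.pderiv
  have h3 : ∀ w, ∃ c, pderiv w (pderiv v (mon K μ.1)) = C c := fun w =>
    ⟨_, totalDegree_eq_zero_iff_eq_C.mp (Nat.le_zero.mp (h2.pderiv (i := w)).totalDegree_le)⟩
  choose c hc using h3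
  have h4 := h2.sum_X_mul_pderiv
  simp only [hc, one_smul] at h4
  simp only [tg, Finset.sum_apply, Pi.smul_apply, smul_eq_mul, ← h4, map_sum, map_mul, eval_X,
    eval_C]
  refine Finset.sum_congr rfl fun w _ => ?_
  rw [Finset.sum_eq_single w]
  · simp
  · intro i _ hi; simp [hi]
  · simp

theorem rankGE_two [CharZero K] [Nonempty σ] {e : ℕ} (he : Fintype.card σ ≤ e) :
    RankGE K σ 2 e ((Fintype.card σ + 1).choose 2) := by
  classical
  obtain ⟨f, hf⟩ : ∃ f : Fin e → σ, Function.Surjective f := by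
    obtain ⟨g⟩ := Function.Embedding.nonempty_of_card_le (α := σ) (β := Fin e) (by simpa using he)
    exact ⟨Function.invFun g, Function.invFun_surjective g.injective⟩
  refine ⟨fun j => Pi.single (f j) 1, ?_⟩
  have h1 : dspan 2 (fun j => (Pi.single (f j) 1 : σ → K)) = ⊤ := by
    rw [← top_le_iff, ← span_range_ev, Submodule.span_le]
    rintro _ ⟨p, rfl⟩
    rw [SetLike.mem_coe, ev_eq_dv two_ne_zero, dv_apply]
    refine Submodule.sum_mem _ fun v _ => Submodule.smul_mem _ _ ?_
    rw [tg_two]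
    refine Submodule.sum_mem _ fun w _ => Submodule.smul_mem _ _ ?_
    obtain ⟨j, rfl⟩ := hf w
    exact Submodule.subset_span ⟨(j, v), rfl⟩
  rw [h1, finrank_top, finrank_mon]
  rfl

theorem good_horace_fin [CharZero K] (hd : d ≠ 0) {m k e D : ℕ} (h1 : Good K (Fin (m + 1)) (d + 2) k)
    (h2 : Good K (Fin (m + 2)) (d + 1) e) (h3 : RankGE K (Option (Fin (m + 1))) d e D)
    (h : e * (m + 2) + k ≤ (m + 1 + d).choose (d + 1) + D) :
    Good K (Fin (m + 2)) (d + 2) (e + k) :=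
  (good_horace hd h1 (h2.congr (_root_.finSuccEquiv (m + 1))) h3 (by simpa using h)).congr
    (_root_.finSuccEquiv (m + 1)).symm

theorem good_two_vars [CharZero K] (d : ℕ) : ∀ q, 2 * q ≤ d + 1 → Good K (Fin 2) d q := by
  induction d using Nat.strong_induction_on with
  | _ d ih =>
  intro q hq
  rcases q with _ | q
  · exact good_zero
  rcases q with _ | q
  · exact good_one (by omega)
  obtain ⟨d, rfl⟩ : ∃ d', d = d' + 2 := ⟨d - 2, by omega⟩
  refine good_horace_fin (by omega) (good_one (by omega)) (ih (d + 1) (by omega) (q + 1) (by omega))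
    ((ih d (by omega) (q + 1) (by omega)).congr (_root_.finSuccEquiv 1)).rankGE ?_
  simp [Nat.add_comm 1 d]

end

section

theorem le_maxGood_mul (m d : ℕ) : (m + d).choose d ≤ maxGood m d * (m + 2) := by
  rw [maxGood]
  have := Nat.lt_div_mul_add (a := (m + d).choose d + m + 1) (b := m + 2) (by omega)
  omega

theorem maxGood_mul_le (m d : ℕ) : maxGood m d * (m + 2) ≤ (m + d).choose d + m + 1 :=
  Nat.div_mul_le_self _ _

theorem choose_four_mul (m : ℕ) : 24 * (m + 4).choose 4 = (m + 1) * (m + 2) * (m + 3) * (m + 4) := by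
  have := Nat.ascFactorial_eq_factorial_mul_choose m 4
  simp [Nat.ascFactorial, Nat.factorial] at this
  linarith

section
variable {M y b q k e : ℕ} (hq : (k + e) * (M + 2) ≤ y + b + M + 1)
    (hk : y ≤ k * (M + 1))
include hq hk

theorem diff_mul_le : e * ((M + 1) * (M + 2)) + y ≤ b * (M + 1) + (M + 1) ^ 2 := by
  have h1 := Nat.mul_le_mul_right (M + 1) hq
  have h2 := Nat.mul_le_mul_right (M + 2) hk
  nlinarith

theorem diff_le {f : ℕ} (hf : b ≤ f * (M + 2)) : e ≤ f := by
  have h1 := diff_mul_le hq hk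
  have h2 := Nat.mul_le_mul_right (M + 1) hf
  by_contra! h
  have h3 := Nat.mul_le_mul_right ((M + 1) * (M + 2)) (Nat.succ_le_of_lt h)
  nlinarith

theorem diff_cond_full (hk' : k * (M + 1) ≤ y + M)
    (h : y + (M + 1) * (M * (M + 2)) ≤ b * (M + 1)) :
    e * (M + 1) + k ≤ b := by
  have h1 := Nat.mul_le_mul_right (M + 1) (diff_mul_le hq hk)
  have h2 := Nat.mul_le_mul_right (M + 2) hk'
  by_contra! hc
  have h3 := Nat.mul_le_mul_right ((M + 1) * (M + 2)) (Nat.succ_le_of_lt hc)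
  nlinarith

theorem diff_cond_partial {w x q₀ : ℕ} (hb : b = w + x) (hk' : k * (M + 1) ≤ y + M)
    (hw : w ≤ q₀ * (M + 2)) (h : 2 * y + (M + 1) * (M * M + M) ≤ 2 * (x * (M + 1)) + (M + 1)) :
    e * M + k ≤ x + q₀ * M := by
  have h1 := Nat.mul_le_mul_right M (diff_mul_le hq hk)
  have h2 := Nat.mul_le_mul_right (M + 2) hk'
  have h4 := Nat.mul_le_mul_right (M * (M + 1)) hw
  by_contra! hc
  have h3 := Nat.mul_le_mul_right ((M + 1) * (M + 2)) (Nat.succ_le_of_lt hc)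
  subst hb
  nlinarith

end

theorem mul_maxGood_pred_le {M δ : ℕ} {x y k : ℕ} (hx : y * (δ + 2) = x * (M + δ + 1))
    (hk' : k * (M + 1) ≤ y + M) : k ≤ x := by
  by_contra! hc
  have h3 := Nat.mul_le_mul_right (M + 1) (Nat.succ_le_of_lt hc)
  have h4 : y ≤ x * (M + 1) := by
    refine Nat.le_of_mul_le_mul_right ?_ (Nat.succ_pos (δ + 1))
    nlinarith [Nat.zero_le (x * (M * δ)), Nat.zero_le (x * M)]
  nlinarith

theorem maxGood_le_succ (m d : ℕ) (hd : 1 ≤ d) : maxGood m d ≤ maxGood (m + 1) d := by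
  obtain ⟨d, rfl⟩ : ∃ d', d = d' + 1 := ⟨d - 1, by omega⟩
  have h1 := maxGood_mul_le m (d + 1)
  have h2 := le_maxGood_mul (m + 1) (d + 1)
  have h3 : (m + 1 + (d + 1)).choose (d + 1) * (m + 1) = (m + (d + 1)).choose (d + 1) * (m + d + 2) := by
    have := Nat.choose_mul_succ_eq (m + (d + 1)) (d + 1)
    rw [show m + (d + 1) + 1 - (d + 1) = m + 1 by omega] at this
    rw [show m + 1 + (d + 1) = m + (d + 1) + 1 by omega, ← this]
    ring
  generalize (m + 1 + (d + 1)).choose (d + 1) = c at *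
  generalize (m + (d + 1)).choose (d + 1) = y at *
  generalize maxGood m (d + 1) = k at *
  generalize maxGood (m + 1) (d + 1) = q at *
  have h4 : y * (m + 3) ≤ c * (m + 2) := by
    refine Nat.le_of_mul_le_mul_right ?_ (Nat.succ_pos m)
    nlinarith [Nat.zero_le (y * (m * d)), Nat.zero_le (y * m), Nat.zero_le (y * d)]
  by_contra! hc
  have h5 := Nat.mul_le_mul_right (m + 2) (Nat.succ_le_of_lt hc)
  have h6 : y < (q + 1) * (m + 2) := by nlinarith
  have h7 : y ≤ q * (m + 2) := by
    refine Nat.le_of_mul_le_mul_right ?_ (Nat.succ_pos (m + 2))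
    nlinarith
  nlinarith

end

section
variable {K : Type*} [Field K]

theorem cond_full {M y b δ : ℕ} (hM : 2 ≤ M) (hδ : 3 ≤ δ) (hy : y * (δ + 2) = b * M)
    (hb : (M + 1) * (M + 2) * (M + 3) * (M + 4) ≤ 24 * b) :
    y + (M + 1) * (M * (M + 2)) ≤ b * (M + 1) := by
  have h1 : 5 * y ≤ b * M := by nlinarith
  have h2 : 120 * M ≤ (M + 3) * (M + 4) * (4 * M + 5) := by nlinarith [Nat.zero_le (M * M * M)]
  have h3 := Nat.mul_le_mul_left ((M + 1) * (M + 2)) h2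
  have h4 := Nat.mul_le_mul_right (4 * M + 5) hb
  nlinarith

theorem cond_partial {M y x δ : ℕ} (hM : 2 ≤ M) (hδ : 3 ≤ δ)
    (hy : y * (δ + 2) = x * (M + δ + 1)) (hx : M * (M + 1) * (M + 2) * (M + 3) ≤ 24 * x) :
    2 * y + (M + 1) * (M * M + M) ≤ 2 * (x * (M + 1)) + (M + 1) := by
  have h0 : x ≤ y := by
    refine Nat.le_of_mul_le_mul_right ?_ (Nat.succ_pos (δ + 1))
    nlinarith
  have h1 : 5 * y ≤ x * (M + 4) := by nlinarith
  have h2 : 60 * (M * M + M) ≤ (M + 3) * (M + 2) * M * (4 * M + 1) + 60 := by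
    obtain ⟨a, rfl⟩ := Nat.exists_eq_add_of_le hM
    nlinarith [Nat.zero_le (a * a * a), Nat.zero_le (a * a * a * a), Nat.zero_le (a * a)]
  have h3 := Nat.mul_le_mul_left (M + 1) h2
  have h4 := Nat.mul_le_mul_right (4 * M + 1) hx
  nlinarith

theorem good_maxGood_step [CharZero K] {m δ : ℕ} (hm : 1 ≤ m) (hδ : 3 ≤ δ)
    (h0 : Good K (Fin (m + 1)) (δ + 2) (maxGood m (δ + 2)))
    (h1 : Good K (Fin (m + 2)) (δ + 1) (maxGood (m + 1) (δ + 1)))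
    (h2 : Good K (Fin (m + 2)) δ (maxGood (m + 1) δ)) :
    Good K (Fin (m + 2)) (δ + 2) (maxGood (m + 1) (δ + 2)) := by
  obtain ⟨e, he⟩ := Nat.exists_eq_add_of_le (maxGood_le_succ m (δ + 2) (by omega))
  have hq := maxGood_mul_le (m + 1) (δ + 2)
  have hk := le_maxGood_mul m (δ + 2)
  have hk' := maxGood_mul_le m (δ + 2)
  have hf := le_maxGood_mul (m + 1) (δ + 1)
  have hw := le_maxGood_mul (m + 1) δ
  have e1 := Nat.choose_succ_right_eq (m + 1 + δ) δ
  have e2 := Nat.choose_succ_right_eq (m + δ + 2) (δ + 1)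
  rw [show m + 1 + δ - δ = m + 1 by omega] at e1
  rw [show m + δ + 2 - (δ + 1) = m + 1 by omega] at e2
  have e3 : (m + δ + 2).choose (δ + 1) = (m + 1 + δ).choose δ + (m + 1 + δ).choose (δ + 1) := by
    rw [← Nat.choose_succ_succ]; congr 1; omega
  have e4 : (m + 1 + (δ + 2)).choose (δ + 2) =
      (m + δ + 2).choose (δ + 1) + (m + δ + 2).choose (δ + 2) := by
    rw [← Nat.choose_succ_succ]; congr 1; omega
  have hx : (m + 1) * (m + 2) * (m + 3) * (m + 4) ≤ 24 * (m + 1 + δ).choose (δ + 1) := by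
    rw [← choose_four_mul, Nat.choose_symm_of_eq_add (show m + 1 + δ = (δ + 1) + m by omega),
      ← Nat.choose_symm_add (a := m)]
    exact Nat.mul_le_mul_left _ (Nat.choose_le_choose _ (by omega))
  have hb : (m + 2) * (m + 3) * (m + 4) * (m + 5) ≤ 24 * (m + δ + 2).choose (δ + 1) := by
    rw [← choose_four_mul (m + 1), Nat.choose_symm_of_eq_add
      (show m + δ + 2 = (δ + 1) + (m + 1) by omega), ← Nat.choose_symm_add (a := m + 1)]
    exact Nat.mul_le_mul_left _ (Nat.choose_le_choose _ (by omega))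
  rw [he] at hq ⊢
  rw [e4] at hq
  rw [show m + (δ + 2) = m + δ + 2 by omega] at hk hk'
  rw [show m + 1 + (δ + 1) = m + δ + 2 by omega] at hf
  have hkp : 1 ≤ m := hm
  clear he e4
  generalize maxGood m (δ + 2) = k at *
  generalize maxGood (m + 1) (δ + 1) = f at *
  generalize maxGood (m + 1) δ = q₀ at *
  generalize hxe : (m + 1 + δ).choose (δ + 1) = x at *
  generalize hwe : (m + 1 + δ).choose δ = w at *
  generalize (m + δ + 2).choose (δ + 1) = b at *
  generalize (m + δ + 2).choose (δ + 1 + 1) = y at *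
  have hq' : (k + e) * (m + 1 + 2) ≤ y + b + (m + 1) + 1 := by omega
  have hk2 : k * (m + 1 + 1) ≤ y + (m + 1) := by nlinarith
  have e5 : y * (δ + 2) = x * (m + 1 + δ + 1) := by
    rw [e2, e3]; linarith
  have hef : e ≤ f := diff_le hq' hk hf
  rw [add_comm k e]
  rcases le_total e q₀ with hle | hle
  · refine good_horace_fin (by omega) h0 (h1.mono hef)
      ((h2.mono hle).congr (_root_.finSuccEquiv (m + 1))).rankGE ?_
    have := mul_maxGood_pred_le e5 hk2
    rw [hxe]
    simp only [Fintype.card_option, Fintype.card_fin]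
    linarith
  · refine good_horace_fin (by omega) h0 (h1.mono hef)
      ((h2.congr (_root_.finSuccEquiv (m + 1))).rankGE_add (by omega) hle) ?_
    have c1 := diff_cond_full hq' hk hk2 (cond_full (by omega) hδ e2 hb)
    have c2 := diff_cond_partial hq' hk e3 hk2 hw (cond_partial (by omega) hδ e5 hx)
    rw [hxe]
    simp only [Fintype.card_option, Fintype.card_fin]
    rw [show m + 1 + 1 + δ - 1 = m + 1 + δ by omega, hwe]
    rcases min_choice w (q₀ * (m + 1 + 1) + (e - q₀)) with h | h <;> rw [h]
    · rw [e3] at c1; linarith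
    · zify [hle] at c2 ⊢
      linarith

theorem good_four [CharZero K] {m : ℕ} (hm : 1 ≤ m)
    (h0 : Good K (Fin (m + 1)) 4 (maxGood m 4)) : Good K (Fin (m + 2)) 4 (maxGood (m + 1) 4) := by
  have h1 : Good K (Fin (m + 2)) 3 (maxGood (m + 1) 3) := good_three (by omega)
  rcases Nat.lt_or_ge m 4 with hm4 | hm4
  · interval_cases m
    · have e1 : maxGood 1 4 = 2 := by decide
      have e2 : maxGood (1 + 1) 4 = 4 := by decide
      have e3 : maxGood (1 + 1) 3 = 3 := by decide
      rw [e1] at h0; rw [e2]; rw [e3] at h1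
      exact good_horace_fin (e := 2) two_ne_zero h0 (h1.mono (by omega))
        ((good_one two_ne_zero).rankGE_add two_ne_zero (by omega)) (by decide)
    · have e1 : maxGood 2 4 = 4 := by decide
      have e2 : maxGood (2 + 1) 4 = 7 := by decide
      have e3 : maxGood (2 + 1) 3 = 4 := by decide
      rw [e1] at h0; rw [e2]; rw [e3] at h1
      exact good_horace_fin (e := 3) two_ne_zero h0 (h1.mono (by omega))
        ((good_one two_ne_zero).rankGE_add two_ne_zero (by omega)) (by decide)
    · have e1 : maxGood 3 4 = 7 := by decide
      have e2 : maxGood (3 + 1) 4 = 12 := by decide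
      have e3 : maxGood (3 + 1) 3 = 6 := by decide
      rw [e1] at h0; rw [e2]; rw [e3] at h1
      exact good_horace_fin (e := 5) two_ne_zero h0 (h1.mono (by omega))
        (rankGE_two (by simp)) (by decide)
  · obtain ⟨e, he⟩ := Nat.exists_eq_add_of_le (maxGood_le_succ m 4 (by omega))
    have hq := maxGood_mul_le (m + 1) 4
    have hq2 := le_maxGood_mul (m + 1) 4
    have hk := le_maxGood_mul m 4
    have hk' := maxGood_mul_le m 4
    have hf := le_maxGood_mul (m + 1) 3
    have e1 := choose_four_mul m
    have e2 := choose_three_mul (m + 1)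
    have e3 := choose_four_mul (m + 1)
    have e4 : (m + 1 + 4).choose 4 = (m + 4).choose 3 + (m + 4).choose 4 := by
      rw [← Nat.choose_succ_succ]
    have e5 : (m + 4).choose 3 = (m + 3).choose 2 + (m + 3).choose 3 := by
      rw [← Nat.choose_succ_succ]
    rw [he, e4] at hq hq2
    rw [show m + 1 + 3 = m + 4 by omega] at hf e2
    rw [he, add_comm (maxGood m 4) e]
    clear he e4
    have hD : (m + 1 + 2).choose (2 + 1) + (m + 1 + 1 + 1).choose 2 = (m + 4).choose 3 := by
      rw [e5, add_comm]
    clear e5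
    generalize maxGood m 4 = k at *
    generalize maxGood (m + 1) 3 = f at *
    generalize (m + 4).choose 3 = b at *
    generalize (m + 4).choose 4 = y at *
    have hq' : (k + e) * (m + 1 + 2) ≤ y + b + (m + 1) + 1 := by omega
    have hk2 : k * (m + 1 + 1) ≤ y + (m + 1) := by nlinarith
    have hy : 4 * y = (m + 1) * b := by nlinarith
    have c1 : e * (m + 1 + 1) + k ≤ b := by
      refine diff_cond_full hq' hk hk2 ?_
      have h2 : 24 * (m + 1) ≤ (m + 4) * (3 * m + 7) := by nlinarith
      have h3 := Nat.mul_le_mul_left ((m + 2) * (m + 3)) h2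
      nlinarith
    have c2 : m + 2 ≤ e := by
      by_contra! hc
      have h1 := Nat.mul_le_mul_right ((m + 2) * (m + 3)) (Nat.le_of_lt_succ hc)
      have h2 := Nat.mul_le_mul_right (m + 2) hq2
      have h3 := Nat.mul_le_mul_right (m + 3) hk2
      have h4 : 24 * (m + 1) * (m + 3) < (m + 2) * (m + 4) * (3 * m + 7) := by
        nlinarith [Nat.zero_le (m * m * m)]
      have h5 := Nat.mul_lt_mul_of_pos_left h4 (show 0 < m + 3 by omega)
      nlinarith
    refine good_horace_fin two_ne_zero h0 (h1.mono (diff_le hq' hk hf))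
      (rankGE_two (by simpa using Nat.lt_of_succ_le c2)) ?_
    simp only [Fintype.card_option, Fintype.card_fin]
    rw [hD]
    exact c1

theorem good_maxGood [CharZero K] (m : ℕ) : ∀ d, 3 ≤ d → Good K (Fin (m + 2)) d (maxGood (m + 1) d) := by
  induction m with
  | zero =>
    intro d hd
    refine good_two_vars d _ ?_
    have := maxGood_mul_le 1 d
    rw [add_comm 1 d, Nat.choose_succ_self_right] at this
    simp only [zero_add]
    omega
  | succ m ih =>
    intro d hd
    induction d using Nat.strong_induction_on with
    | _ d ihd =>
    rcases Nat.lt_or_ge d 5 with h | h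
    · interval_cases d
      · exact good_three (by omega)
      · exact good_four (by omega) (ih 4 (by omega))
    · obtain ⟨δ, rfl⟩ : ∃ δ, d = δ + 2 := ⟨d - 2, by omega⟩
      exact good_maxGood_step (by omega) (by omega) (ih _ (by omega)) (ihd _ (by omega) (by omega))
        (ihd _ (by omega) (by omega))
end

section SegreVeronese

variable {K : Type*} [Field K] {I σ : Type*} [Fintype σ] {d : ℕ}

/-- Generators of the affine tangent space to the Segre–Veronese cone at `a ⊗ b ^ d`. -/
noncomputable def svTangent [DecidableEq I] (d : ℕ) (a : I → K) (b : σ → K) :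
    I ⊕ σ → I × Mon σ d → K :=
  Sum.elim (fun i p => if p.1 = i then ev d b p.2 else 0) (fun l p => a p.1 * tg d b l p.2)

theorem linearIndependent_block [Fintype I] [DecidableEq I] {M ρ : Type*} [Fintype ρ]
    (v : I → ρ → M → K) (h : ∀ i, LinearIndependent K (v i)) :
    LinearIndependent K fun (x : I × ρ) (p : I × M) => if p.1 = x.1 then v x.1 x.2 p.2 else 0 := by
  rw [Fintype.linearIndependent_iff]
  rintro g hg ⟨i, x⟩
  refine Fintype.linearIndependent_iff.mp (h i) (fun x => g (i, x)) ?_ x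
  ext μ
  have := congrFun hg (i, μ)
  simpa [Fintype.sum_prod_type, Finset.sum_apply, Finset.sum_ite_irrel] using this

/-- The conditions imposed by double points `b (i, ·)` and simple points `b (i', ·)`, `i' ≠ i`. -/
noncomputable def mixed (d : ℕ) {κ : Type*} (b : I × κ → σ → K) (i : I) :
    (κ × σ) ⊕ ({i' // i' ≠ i} × κ) → Mon σ d → K :=
  Sum.elim (fun x => tg d (b (i, x.1)) x.2) (fun x => ev d (b (x.1, x.2)))

theorem eventually_le_rk_mixed [Infinite K] [Fintype I] [DecidableEq I] {κ : Type*} [Fintype κ]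
    (i : I) (h : Good K σ d (Fintype.card κ)) :
    ∀ᶠ b in zar K ((I × κ) × σ),
      min ((Fintype.card σ + d - 1).choose d)
        (Fintype.card κ * (Fintype.card σ + Fintype.card I - 1)) ≤
      rk K (mixed d (fun x v => b (x, v)) i) := by
  obtain ⟨p, hp⟩ := h
  obtain ⟨f, hf⟩ := exists_min_le_finrank_sup (dspan d p) (ev (K := K) (σ := σ) d)
    (Fintype.card ({i' // i' ≠ i} × κ))
  rw [span_range_ev, sup_top_eq, finrank_top, finrank_mon, hp.finrank_dspan, Fintype.card_fin] at hf
  have hI : 1 ≤ Fintype.card I := Fintype.card_pos_iff.mpr ⟨i⟩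
  have hcard : Fintype.card κ * Fintype.card σ + Fintype.card ({i' // i' ≠ i} × κ) =
      Fintype.card κ * (Fintype.card σ + Fintype.card I - 1) := by
    rw [Fintype.card_prod, Fintype.card_subtype_compl, Fintype.card_subtype_eq,
      Nat.add_sub_assoc hI]
    ring
  simp only [hcard] at hf
  let e := Fintype.equivFin κ
  let e' := Fintype.equivFin ({i' // i' ≠ i} × κ)
  let b₀ : (I × κ) → σ → K := fun x =>
    if hx : x.1 = i then p (e x.2) else f (e' (⟨x.1, hx⟩, x.2))
  have key := eventually_zar_le_rk (K := K) (σ := (I × κ) × σ)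
    (Sum.elim (fun x : κ × σ => tgPoly K d (i, x.1) x.2)
      (fun x : {i' // i' ≠ i} × κ => evPoly K d ((x.1 : I), x.2))) (fun x => b₀ x.1 x.2)
    (min ((Fintype.card σ + d - 1).choose d)
        (Fintype.card κ * (Fintype.card σ + Fintype.card I - 1))) ?_
  · filter_upwards [key] with b hb
    convert hb using 2
    ext (x | x) μ
    · simp [mixed, eval_tgPoly]
    · simp [mixed, eval_evPoly]
  · refine hf.trans ?_
    rw [rk]
    apply Submodule.finrank_mono
    rw [sup_le_iff, dspan, Submodule.span_le, Submodule.span_le]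
    constructor
    · rintro _ ⟨⟨j, v⟩, rfl⟩
      refine Submodule.subset_span ⟨Sum.inl (e.symm j, v), ?_⟩
      ext μ
      simp [eval_tgPoly, b₀]
    · rintro _ ⟨j, rfl⟩
      obtain ⟨⟨⟨i', hi'⟩, x⟩, rfl⟩ := e'.surjective j
      refine Submodule.subset_span ⟨Sum.inr (⟨i', hi'⟩, x), ?_⟩
      ext μ
      simp [eval_evPoly, b₀, hi']

theorem exists_le_rk_svTangent [Infinite K] [Fintype I] [DecidableEq I] {κ : Type*} [Fintype κ]
    (h : Good K σ d (Fintype.card κ)) :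
    ∃ (a : I × κ → I → K) (b : I × κ → σ → K), (∀ x v, b x v ≠ 0) ∧
      Fintype.card I * min ((Fintype.card σ + d - 1).choose d)
        (Fintype.card κ * (Fintype.card σ + Fintype.card I - 1)) ≤
      rk K fun x : (I × κ) × (I ⊕ σ) => svTangent d (a x.1) (b x.1) x.2 := by
  obtain ⟨b, hb, hb0⟩ := ((Filter.eventually_all.mpr fun i : I =>
    eventually_le_rk_mixed (K := K) i h).and (Filter.eventually_all.mpr fun x : (I × κ) × σ =>
      eventually_zar_apply_ne_zero (K := K) x)).exists
  refine ⟨fun x => Pi.single x.1 1, fun x v => b (x, v), fun x v => hb0 _, ?_⟩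
  choose f hf using fun i => exists_linearIndependent_of_le_rk _ _ (hb i)
  have := linearIndependent_block _ hf
  let g : ∀ i : I, (κ × σ) ⊕ ({i' // i' ≠ i} × κ) → (I × κ) × (I ⊕ σ) := fun i =>
    Sum.elim (fun x => ((i, x.1), Sum.inr x.2)) (fun x => ((x.1, x.2), Sum.inl i))
  refine le_trans ?_ (le_rk_of_linearIndependent (β := I × Fin _)
    (fun x : (I × κ) × (I ⊕ σ) => svTangent d (Pi.single x.1.1 1) (fun v => b (x.1, v)) x.2)
    (fun x => g x.1 (f x.1 x.2)) ?_)
  · simp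
  convert this using 2 with x
  obtain ⟨i, x⟩ := x
  ext ⟨i', μ⟩
  rcases hx : f i x with y | y
  · by_cases hi : i' = i <;> simp [g, svTangent, mixed, hx, hi]
  · by_cases hi : i' = i <;> simp [g, svTangent, mixed, hx, hi]
  rfl

end SegreVeronese

section AffineChart

variable {K : Type*} [Field K] {I : Type*} [DecidableEq I] {m d : ℕ}

/-- Generators of the tangent space in the chart where the first coordinate of `b` is fixed. -/
noncomputable def svChartTangent (d : ℕ) (a : I → K) (b : Fin (m + 1) → K) (x : I ⊕ Fin m) :
    I × Mon (Fin (m + 1)) d → K :=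
  svTangent d a b (Sum.map id Fin.succ x)

theorem svTangent_mem_span_svChartTangent [Fintype I] (a : I → K) (b : Fin (m + 1) → K)
    (hb : b 0 ≠ 0) (x : I ⊕ Fin (m + 1)) :
    svTangent d a b x ∈ Submodule.span K (Set.range (svChartTangent d a b)) := by
  rcases x with i | l
  · exact Submodule.subset_span ⟨Sum.inl i, rfl⟩
  refine Fin.cases ?_ (fun l => Submodule.subset_span ⟨Sum.inr l, rfl⟩) l
  have h : svTangent d a b (Sum.inr 0) = (b 0)⁻¹ • ((d : K) • ∑ i, a i • svChartTangent d a b (Sum.inl i)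
      - ∑ l, b l.succ • svChartTangent d a b (Sum.inr l)) := by
    ext ⟨i, μ⟩
    have := congrFun (dv_self (d := d) b) μ
    rw [dv_apply, Fin.sum_univ_succ] at this
    simp only [Pi.add_apply, Pi.smul_apply, smul_eq_mul, Finset.sum_apply] at this
    simp only [svChartTangent, svTangent, Sum.map_inl, Sum.map_inr, Sum.elim_inl, Sum.elim_inr,
      Pi.sub_apply, Pi.smul_apply, smul_eq_mul, Finset.sum_apply, id]
    rw [eq_inv_mul_iff_mul_eq₀ hb]
    simp only [mul_ite, mul_zero, Finset.sum_ite_eq, Finset.mem_univ, if_true]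
    have h2 : ∑ x : Fin m, b x.succ * (a i * tg d b x.succ μ) =
        a i * ∑ x : Fin m, b x.succ * tg d b x.succ μ := by
      rw [Finset.mul_sum]; exact Finset.sum_congr rfl fun _ _ => by ring
    rw [h2]
    linear_combination a i * this
  rw [h]
  refine Submodule.smul_mem _ _ (Submodule.sub_mem _ (Submodule.smul_mem _ _ ?_) ?_) <;>
  exact Submodule.sum_mem _ fun i _ => Submodule.smul_mem _ _ (Submodule.subset_span ⟨_, rfl⟩)

/-- The joint tangent vectors of some points of the Segre–Veronese cone. -/
noncomputable def svFamily {T : Type*} (d : ℕ) (a : T → I → K) (b : T → Fin (m + 1) → K)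
    (x : T × (I ⊕ Fin m)) : I × Mon (Fin (m + 1)) d → K :=
  svChartTangent d (a x.1) (b x.1) x.2

theorem rk_svTangent_le [Fintype I] {T : Type*} (a : T → I → K) (b : T → Fin (m + 1) → K)
    (hb : ∀ t, b t 0 ≠ 0) :
    rk K (fun x : T × (I ⊕ Fin (m + 1)) => svTangent d (a x.1) (b x.1) x.2) ≤
      rk K (svFamily d a b) := by
  refine Submodule.finrank_mono (Submodule.span_le.mpr ?_)
  rintro _ ⟨⟨t, x⟩, rfl⟩
  refine Submodule.span_mono ?_ (svTangent_mem_span_svChartTangent (a t) (b t) (hb t) x)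
  rintro _ ⟨y, rfl⟩
  exact ⟨(t, y), rfl⟩

theorem exists_le_rk_svFamily [CharZero K] {n k : ℕ} (hd : 3 ≤ d)
    (hk : k ≤ maxGood (m + 1) d) :
    ∃ (a : Fin (n + 1) × Fin k → Fin (n + 1) → K) (b : Fin (n + 1) × Fin k → Fin (m + 2) → K),
      (∀ t, b t 0 ≠ 0) ∧
      (n + 1) * min ((m + 1 + d).choose d) (k * (m + 1 + n + 1)) ≤ rk K (svFamily d a b) := by
  have hg : Good K (Fin (m + 2)) d (Fintype.card (Fin k)) := by
    rw [Fintype.card_fin]; exact (good_maxGood m d hd).mono hk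
  obtain ⟨a, b, hb, h⟩ := exists_le_rk_svTangent (I := Fin (n + 1)) hg
  refine ⟨a, b, fun t => hb t 0, ?_⟩
  refine le_trans (le_of_eq ?_) (h.trans (rk_svTangent_le a b fun t => hb t 0))
  simp only [Fintype.card_fin]
  congr 3 <;> omega

/-- The secant cone contains a point whose tangent space has dimension at least `r`. -/
def SvRank (K : Type*) [Field K] (n m d s r : ℕ) : Prop :=
  ∃ (a : Fin s → Fin (n + 1) → K) (b : Fin s → Fin (m + 1) → K), (∀ t, b t 0 ≠ 0) ∧
    r ≤ rk K (svFamily d a b)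

theorem svRank_of_le [CharZero K] {n k s : ℕ} (hd : 3 ≤ d) (hk : k ≤ maxGood (m + 1) d)
    (hkc : k * (m + 1 + n + 1) ≤ (m + 1 + d).choose d) (hs : s ≤ (n + 1) * k) :
    SvRank K n (m + 1) d s (s * (n + (m + 1) + 1)) := by
  obtain ⟨a, b, hb, h⟩ := exists_le_rk_svFamily (K := K) (n := n) hd hk
  rw [min_eq_right hkc] at h
  have hli : LinearIndependent K (svFamily d a b) := by
    rw [linearIndependent_iff_card_le_finrank_span]
    refine le_trans (le_of_eq ?_) h
    simp only [Fintype.card_prod, Fintype.card_sum, Fintype.card_fin]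
    ring
  let e : Fin s → Fin (n + 1) × Fin k := fun i => finProdFinEquiv.symm (Fin.castLE hs i)
  have he : Function.Injective e := finProdFinEquiv.symm.injective.comp (Fin.castLE_injective hs)
  refine ⟨a ∘ e, b ∘ e, fun t => hb _, ?_⟩
  have := hli.comp (Prod.map e id) (he.prodMap Function.injective_id)
  refine le_trans (le_of_eq ?_) (le_of_eq (finrank_span_eq_card this).symm)
  simp only [Fintype.card_prod, Fintype.card_sum, Fintype.card_fin]
  ring

theorem svRank_of_ge [CharZero K] {n k s : ℕ} (hd : 3 ≤ d) (hk : k ≤ maxGood (m + 1) d)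
    (hkc : (m + 1 + d).choose d ≤ k * (m + 1 + n + 1)) (hs : (n + 1) * k ≤ s) :
    SvRank K n (m + 1) d s ((n + 1) * (m + 1 + d).choose d) := by
  obtain ⟨a, b, hb, h⟩ := exists_le_rk_svFamily (K := K) (n := n) hd hk
  rw [min_eq_left hkc] at h
  let e : Fin (n + 1) × Fin k → Fin s := fun x => Fin.castLE hs (finProdFinEquiv x)
  have he : Function.Injective e := (Fin.castLE_injective hs).comp finProdFinEquiv.injective
  refine ⟨Function.extend e a 0, Function.extend e b 1, fun t => ?_, h.trans ?_⟩
  · by_cases ht : ∃ x, e x = t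
    · obtain ⟨x, rfl⟩ := ht
      rw [he.extend_apply]; exact hb x
    · rw [Function.extend_apply' _ _ _ ht]; exact one_ne_zero
  · refine Submodule.finrank_mono (Submodule.span_mono ?_)
    rintro _ ⟨⟨x, y⟩, rfl⟩
    exact ⟨(e x, y), by simp only [svFamily, he.extend_apply]⟩

end AffineChart

theorem mem_vIdeal {K : Type} [Field K] {ι : Type} {S : Set (ι → K)} {P : MvPolynomial ι K} :
    P ∈ vIdeal K S ↔ ∀ y ∈ S, eval y P = 0 := by
  simp [vIdeal, RingHom.mem_ker]

section ChartMap

variable {K : Type} [Field K] {n m d s : ℕ}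

theorem mem_secantCone_svCone {y : Fin (n + 1) × Mon (Fin (m + 1)) d → K} :
    y ∈ secantCone K (svCone K n m d) s ↔
      ∃ (a : Fin s → Fin (n + 1) → K) (b : Fin s → Fin (m + 1) → K),
        y = fun p => ∑ t, a t p.1 * ∏ l, b t l ^ p.2.1 l := by
  constructor
  · rintro ⟨x, hx, rfl⟩
    choose a b h using hx
    refine ⟨a, b, ?_⟩
    ext p
    simp [h]
  · rintro ⟨a, b, rfl⟩
    refine ⟨fun t p => a t p.1 * ∏ l, b t l ^ p.2.1 l, fun t => ⟨a t, b t, rfl⟩, ?_⟩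
    ext p
    simp

/-- The generic point of `P^m` in the chart where the first coordinate is `β t`. -/
noncomputable def chartPoint (n m : ℕ) (β : Fin s → K) (t : Fin s) :
    Fin (m + 1) → MvPolynomial (Fin s × (Fin (n + 1) ⊕ Fin m)) K :=
  Fin.cons (C (β t)) fun l => X (t, Sum.inr l)

/-- The parametrization of the secant cone, restricted to a chart of `P^m`. -/
noncomputable def chartMap (n m d : ℕ) (β : Fin s → K) :
    MvPolynomial (Fin (n + 1) × Mon (Fin (m + 1)) d) K →ₐ[K]
      MvPolynomial (Fin s × (Fin (n + 1) ⊕ Fin m)) K :=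
  aeval fun p => ∑ t, X (t, Sum.inl p.1) * aeval (chartPoint n m β t) (mon K p.2.1)

theorem eval_chartPoint (β : Fin s → K) (q : Fin s × (Fin (n + 1) ⊕ Fin m) → K) (t : Fin s) :
    (fun l => eval q (chartPoint n m β t l)) = Fin.cons (β t) fun l => q (t, Sum.inr l) := by
  ext l
  refine Fin.cases ?_ (fun l => ?_) l <;> simp [chartPoint]

theorem eval_aeval_chartPoint (β : Fin s → K) (q : Fin s × (Fin (n + 1) ⊕ Fin m) → K) (t : Fin s)
    (P : MvPolynomial (Fin (m + 1)) K) :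
    eval q (aeval (chartPoint n m β t) P) =
      eval (Fin.cons (β t) fun l => q (t, Sum.inr l)) P := by
  rw [← eval_chartPoint (n := n) β q t, ← coe_aeval_eq_eval, ← coe_aeval_eq_eval]
  simp only [RingHom.coe_coe]
  rw [← AlgHom.comp_apply, comp_aeval]

theorem eval_chartMap (β : Fin s → K) (q : Fin s × (Fin (n + 1) ⊕ Fin m) → K)
    (P : MvPolynomial (Fin (n + 1) × Mon (Fin (m + 1)) d) K) :
    eval q (chartMap n m d β P) = eval (fun p => ∑ t, q (t, Sum.inl p.1) *
      ∏ l, (Fin.cons (β t) (fun l => q (t, Sum.inr l)) : Fin (m + 1) → K) l ^ p.2.1 l) P := by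
  rw [chartMap, ← coe_aeval_eq_eval, ← coe_aeval_eq_eval]
  simp only [RingHom.coe_coe]
  rw [← AlgHom.comp_apply, comp_aeval]
  congr 2
  ext p
  have := fun t => eval_aeval_chartPoint (n := n) β q t (mon K p.2.1)
  rw [← coe_aeval_eq_eval] at this
  simp only [RingHom.coe_coe] at this
  simp only [map_sum, map_mul, aeval_X, this]
  simp [mon]

theorem exists_eq_chart {β : Fin s → K} (hβ : ∀ t, β t ≠ 0) (a : Fin s → Fin (n + 1) → K)
    (b : Fin s → Fin (m + 1) → K) (hb : ∀ t, b t 0 ≠ 0) :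
    ∃ q : Fin s × (Fin (n + 1) ⊕ Fin m) → K,
      (fun p : Fin (n + 1) × Mon (Fin (m + 1)) d => ∑ t, a t p.1 * ∏ l, b t l ^ p.2.1 l) =
      fun p => ∑ t, q (t, Sum.inl p.1) *
        ∏ l, (Fin.cons (β t) (fun l => q (t, Sum.inr l)) : Fin (m + 1) → K) l ^ p.2.1 l := by
  refine ⟨fun x => Sum.elim (fun i => a x.1 i * (b x.1 0 / β x.1) ^ d)
    (fun l => β x.1 / b x.1 0 * b x.1 l.succ) x.2, ?_⟩
  ext p
  refine Finset.sum_congr rfl fun t _ => ?_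
  have h : ∀ l, (Fin.cons (β t) (fun l : Fin m => β t / b t 0 * b t l.succ) : Fin (m + 1) → K) l =
      β t / b t 0 * b t l := by
    intro l
    refine Fin.cases ?_ (fun l => ?_) l
    · rw [Fin.cons_zero, div_mul_cancel₀ _ (hb t)]
    · rw [Fin.cons_succ]
  simp only [Sum.elim_inl, Sum.elim_inr, h, mul_pow, Finset.prod_mul_distrib,
    Finset.prod_pow_eq_pow_sum, p.2.2]
  have h1 : (b t 0 / β t) ^ d * (β t / b t 0) ^ d = 1 := by
    rw [← mul_pow, div_mul_div_cancel₀ (hβ t), div_self (hb t), one_pow]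
  linear_combination (-(a t p.1 * ∏ l, b t l ^ p.2.1 l)) * h1

theorem vIdeal_eq_ker_chartMap [Infinite K] {β : Fin s → K} (hβ : ∀ t, β t ≠ 0) :
    vIdeal K (secantCone K (svCone K n m d) s) = RingHom.ker (chartMap n m d β) := by
  ext P
  rw [mem_vIdeal, RingHom.mem_ker]
  constructor
  · intro h
    refine MvPolynomial.funext fun q => ?_
    rw [eval_chartMap, map_zero]
    exact h _ (mem_secantCone_svCone.mpr ⟨fun t i => q (t, Sum.inl i),
      fun t => Fin.cons (β t) fun l => q (t, Sum.inr l), rfl⟩)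
  · intro h y hy
    obtain ⟨a, b, rfl⟩ := mem_secantCone_svCone.mp hy
    let F : MvPolynomial (Fin (n + 1) × Mon (Fin (m + 1)) d) K →ₐ[K]
        MvPolynomial (Fin s × (Fin (n + 1) ⊕ Fin (m + 1))) K :=
      aeval fun p => ∑ t, X (t, Sum.inl p.1) * ∏ l, X (t, Sum.inr l) ^ p.2.1 l
    have hF : ∀ q, eval q (F P) =
        eval (fun p => ∑ t, q (t, Sum.inl p.1) * ∏ l, q (t, Sum.inr l) ^ p.2.1 l) P := by
      intro q
      rw [← coe_aeval_eq_eval, ← coe_aeval_eq_eval]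
      simp only [RingHom.coe_coe, F]
      rw [← AlgHom.comp_apply, comp_aeval]
      congr 2
      ext p
      simp
    have hzero : F P * ∏ t, X (t, Sum.inr 0) = 0 := by
      refine MvPolynomial.funext fun q => ?_
      rw [map_mul, map_zero, map_prod]
      by_cases hq : ∀ t, q (t, Sum.inr 0) ≠ 0
      · obtain ⟨q', hq'⟩ := exists_eq_chart (d := d) hβ (fun t i => q (t, Sum.inl i))
          (fun t l => q (t, Sum.inr l)) hq
        rw [hF, hq', ← eval_chartMap, h, map_zero, zero_mul]
      · push Not at hq
        obtain ⟨t, ht⟩ := hq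
        rw [Finset.prod_eq_zero (Finset.mem_univ t) (by simpa using ht), mul_zero]
    have hFP : F P = 0 := (mul_eq_zero.mp hzero).resolve_right
      (Finset.prod_ne_zero_iff.mpr fun t _ => X_ne_zero _)
    have := hF fun x => Sum.elim (a x.1) (b x.1) x.2
    rw [hFP, map_zero] at this
    exact this.symm

theorem pderiv_aeval_chartPoint (β : Fin s → K) (t t' : Fin s) (l : Fin m)
    (P : MvPolynomial (Fin (m + 1)) K) :
    pderiv (t', Sum.inr l) (aeval (chartPoint n m β t) P) =
      if t' = t then aeval (chartPoint n m β t) (pderiv l.succ P) else 0 := by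
  induction P using MvPolynomial.induction_on with
  | C r => simp [algebraMap_eq]
  | add p q hp hq => rw [map_add, map_add, hp, hq]; split_ifs <;> simp
  | mul_X p j hp =>
    rw [map_mul, Derivation.leibniz, hp, Derivation.leibniz, aeval_X]
    refine Fin.cases ?_ (fun j => ?_) j
    · have h0 : pderiv l.succ (X 0 : MvPolynomial (Fin (m + 1)) K) = 0 :=
        pderiv_X_of_ne (Fin.succ_ne_zero l).symm
      rw [h0]
      simp only [chartPoint, Fin.cons_zero, pderiv_C]
      split_ifs <;> simp
    · simp only [chartPoint, Fin.cons_succ, pderiv_X, Pi.single_apply, Prod.mk.injEq,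
        Sum.inr.injEq, Fin.succ_inj]
      by_cases ht : t' = t
      · subst ht
        by_cases hj : j = l
        · subst hj; simp
        · simp [hj]
      · simp [ht, Ne.symm ht]

theorem pderiv_inl_aeval_chartPoint (β : Fin s → K) (t t' : Fin s) (i : Fin (n + 1))
    (P : MvPolynomial (Fin (m + 1)) K) :
    pderiv (t', Sum.inl i) (aeval (chartPoint n m β t) P) = 0 := by
  induction P using MvPolynomial.induction_on with
  | C r => simp [algebraMap_eq]
  | add p q hp hq => rw [map_add, map_add, hp, hq, add_zero]
  | mul_X p j hp =>
    rw [map_mul, Derivation.leibniz, hp, aeval_X]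
    refine Fin.cases ?_ (fun j => ?_) j
    · simp [chartPoint]
    · simp [chartPoint, pderiv_X]

theorem eval_pderiv_chartMap (a : Fin s → Fin (n + 1) → K) (b : Fin s → Fin (m + 1) → K)
    (x : Fin s × (Fin (n + 1) ⊕ Fin m)) (p : Fin (n + 1) × Mon (Fin (m + 1)) d) :
    eval (fun y => Sum.elim (a y.1) (fun l => b y.1 l.succ) y.2)
      (pderiv x (chartMap n m d (fun t => b t 0) (X p))) = svFamily d a b x p := by
  have hb : ∀ t, (Fin.cons (b t 0) fun l => b t l.succ : Fin (m + 1) → K) = b t := fun t =>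
    Fin.cons_self_tail (b t)
  obtain ⟨t', i | l⟩ := x
  · simp only [chartMap, aeval_X, map_sum, Derivation.leibniz, pderiv_inl_aeval_chartPoint,
      zero_add, pderiv_X, Pi.single_apply, Prod.mk.injEq, Sum.inl.injEq, smul_eq_mul,
      mul_ite, mul_one, mul_zero, apply_ite (eval _), map_zero, eval_aeval_chartPoint,
      Sum.elim_inr, hb]
    by_cases hi : p.1 = i <;>
      simp [hi, svFamily, svChartTangent, svTangent, ev]
  · simp only [chartMap, aeval_X, map_sum, Derivation.leibniz, pderiv_aeval_chartPoint,
      pderiv_X, Pi.single_apply, Prod.mk.injEq, reduceCtorEq, and_false, if_false,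
      add_zero, smul_eq_mul,
      mul_ite, mul_zero, apply_ite (eval _), map_zero, map_mul, eval_aeval_chartPoint,
      Sum.elim_inr, hb, eval_X, Sum.elim_inl]
    simp [svFamily, svChartTangent, svTangent, tg]

theorem SvRank.exists_coneKrullDim [CharZero K] {r : ℕ} (h : SvRank K n m d s r) :
    ∃ D : ℕ, coneKrullDim K (secantCone K (svCone K n m d) s) = D ∧ r ≤ D ∧
      D ≤ s * (n + m + 1) ∧ D ≤ (n + 1) * (m + d).choose d := by
  obtain ⟨a, b, hb, h⟩ := h
  obtain ⟨D, hD, h1, h2, h3⟩ := exists_ringKrullDim_quotient_ker _ _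
    (vIdeal_eq_ker_chartMap (n := n) (m := m) (d := d) hb)
  obtain ⟨f, hf⟩ := exists_linearIndependent_of_le_rk _ r h
  refine ⟨D, hD, h3 (fun y => Sum.elim (a y.1) (fun l => b y.1 l.succ) y.2) r f ?_, ?_, ?_⟩
  · convert hf using 2 with i
    ext p
    exact eval_pderiv_chartMap a b (f i) p
    rfl
  · refine h1.trans (le_of_eq ?_)
    simp only [Fintype.card_prod, Fintype.card_sum, Fintype.card_fin]
    ring
  · refine h2.trans (le_of_eq ?_)
    rw [Fintype.card_prod, Fintype.card_fin, card_mon, Fintype.card_fin]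
    congr 2
    omega

theorem hasProjDim_of_eq {S : Set (Fin (n + 1) × Mon (Fin (m + 1)) d → K)} {D D' : ℕ}
    (h : coneKrullDim K S = D) (hD : D = D' + 1) : HasProjDim K S D' := by
  rw [HasProjDim, h, hD]
  rfl

end ChartMap

/-- **Theorem.**  Let `d ≥ 3`, `n, m ≥ 1`, `N = (n+1)·C(m+d,d) − 1`, `s₁` the largest
multiple of `n+1` at most `⌊(n+1)·C(m+d,d)/(m+n+1)⌋`, `s₂` the smallest multiple of
`n+1` at least `⌈(n+1)·C(m+d,d)/(m+n+1)⌉`.  Then `σ_s(X^{(n,m)}_{(1,d)})` has dimension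
`s(n+m+1) − 1` for `s ≤ s₁` and dimension `N` for `s ≥ s₂`; in particular in both ranges
it has the expected dimension `min {N, s(dim X + 1) − 1} = min {N, s(n+m+1) − 1}`
(the Segre–Veronese variety has dimension `n + m`). -/
theorem stmt2 (K : Type) [Field K] [IsAlgClosed K] [CharZero K]
    (n m d : ℕ) (hd : 3 ≤ d) (hn : 1 ≤ n) (hm : 1 ≤ m)
    (N : ℕ) (hN : N = (n + 1) * ((m + d).choose d) - 1)
    (s₁ s₂ : ℕ)
    (hs₁ : (n + 1) ∣ s₁ ∧ s₁ * (m + n + 1) ≤ (n + 1) * ((m + d).choose d) ∧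
      ∀ s', (n + 1) ∣ s' → s' * (m + n + 1) ≤ (n + 1) * ((m + d).choose d) → s' ≤ s₁)
    (hs₂ : (n + 1) ∣ s₂ ∧ (n + 1) * ((m + d).choose d) ≤ s₂ * (m + n + 1) ∧
      ∀ s', (n + 1) ∣ s' → (n + 1) * ((m + d).choose d) ≤ s' * (m + n + 1) → s₂ ≤ s')
    (s : ℕ) (hs : 1 ≤ s) :
    (s ≤ s₁ → HasProjDim K (secantCone K (svCone K n m d) s) (s * (n + m + 1) - 1)) ∧
    (s₂ ≤ s → HasProjDim K (secantCone K (svCone K n m d) s) N) ∧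
    ((s ≤ s₁ ∨ s₂ ≤ s) →
      HasProjDim K (secantCone K (svCone K n m d) s) (min N (s * (n + m + 1) - 1))) := by
  obtain ⟨m, rfl⟩ := Nat.exists_eq_add_of_le' hm
  obtain ⟨⟨k₁, rfl⟩, h₁, -⟩ := hs₁
  obtain ⟨⟨k₂, rfl⟩, h₂, h₂'⟩ := hs₂
  have hc : 0 < (m + 1 + d).choose d := Nat.choose_pos (by omega)
  have hmax := le_maxGood_mul (m + 1) d
  have hle : maxGood (m + 1) d * (m + 1 + 2) ≤ maxGood (m + 1) d * (m + 1 + n + 1) :=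
    Nat.mul_le_mul_left _ (by omega)
  rw [mul_assoc] at h₁ h₂
  replace h₁ := Nat.le_of_mul_le_mul_left h₁ n.succ_pos
  replace h₂ := Nat.le_of_mul_le_mul_left h₂ n.succ_pos
  have hk₁ : k₁ ≤ maxGood (m + 1) d :=
    Nat.le_of_mul_le_mul_right (h₁.trans (hmax.trans hle)) (by omega)
  have hk₂ : k₂ ≤ maxGood (m + 1) d :=
    Nat.le_of_mul_le_mul_left (h₂' _ (dvd_mul_right _ _) (by
      rw [mul_assoc]; exact Nat.mul_le_mul_left _ (hmax.trans hle))) n.succ_pos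
  have hsub : s ≤ (n + 1) * k₁ →
      s * (n + (m + 1) + 1) ≤ (n + 1) * (m + 1 + d).choose d := fun h =>
    calc s * (n + (m + 1) + 1) ≤ (n + 1) * k₁ * (n + (m + 1) + 1) := Nat.mul_le_mul_right _ h
      _ = (n + 1) * (k₁ * (m + 1 + n + 1)) := by ring
      _ ≤ _ := Nat.mul_le_mul_left _ h₁
  have hsup : (n + 1) * k₂ ≤ s →
      (n + 1) * (m + 1 + d).choose d ≤ s * (n + (m + 1) + 1) := fun h =>
    calc (n + 1) * (m + 1 + d).choose d ≤ (n + 1) * (k₂ * (m + 1 + n + 1)) :=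
          Nat.mul_le_mul_left _ h₂
      _ = (n + 1) * k₂ * (n + (m + 1) + 1) := by ring
      _ ≤ _ := Nat.mul_le_mul_right _ h
  have hpos : 0 < s * (n + (m + 1) + 1) := by positivity
  have hpos' : 0 < (n + 1) * (m + 1 + d).choose d := by positivity
  have low : s ≤ (n + 1) * k₁ → HasProjDim K (secantCone K (svCone K n (m + 1) d) s)
      (s * (n + (m + 1) + 1) - 1) := by
    intro h
    obtain ⟨D, hD, h1, h2, -⟩ := (svRank_of_le (K := K) hd hk₁ h₁ h).exists_coneKrullDim
    exact hasProjDim_of_eq hD (by omega)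
  have high : (n + 1) * k₂ ≤ s → HasProjDim K (secantCone K (svCone K n (m + 1) d) s) N := by
    intro h
    obtain ⟨D, hD, h1, -, h2⟩ := (svRank_of_ge (K := K) hd hk₂ h₂ h).exists_coneKrullDim
    exact hasProjDim_of_eq hD (by omega)
  refine ⟨low, high, fun h => h.elim (fun h => ?_) fun h => ?_⟩
  · rw [min_eq_right (by have := hsub h; omega)]
    exact low h
  · rw [min_eq_left (by have := hsup h; omega)]
    exact high h
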